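/- For all integers k, c, d ≥ 0 there exist integers f(k,c,d), g(k,c,d) ≥ 0 with the following property: for every finite simple graph G that contains no subgraph that is an f(k,c,d)-subdivision of the uniform binary tree H_d, and all sets S, T ⊆ V(G), either (i) there are k+1 paths of G between S and T, pairwise at distance greater than c in G, or (ii) there is a set X ⊆ V(G) with |X| ≤ k such that every path of G between S and T contains a vertex at distance at most g(k,c,d) in G from some member of X. -/

import Mathlib

open SimpleGraph

/-- The distance in a graph `G` between two sets of vertices (`⊤` if no connecting walk). -/
noncomputable def eSetDist {V : Type*} (G : SimpleGraph V) (A B : Set V) : ℕ∞ :=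
  sInf {n : ℕ∞ | ∃ (a b : V) (w : G.Walk a b), a ∈ A ∧ b ∈ B ∧ (w.length : ℕ∞) = n}

/-- The uniform binary tree of depth `d`: vertices are binary strings of length `< d`
(the root is the empty string), and each string is adjacent to its two one-letter
extensions.  For `d ≥ 2` this is exactly the tree `H_d` with a root of degree two, all
other vertices of degree one or three, and all leaves at distance `d-1` from the root. -/
def binTree (d : ℕ) : SimpleGraph {l : List Bool // l.length < d} :=
  SimpleGraph.fromRel (fun a b => ∃ x : Bool, (b : List Bool) = x :: (a : List Bool))

/-- `G` contains an `n`-subdivision of `H` as a subgraph: there is an injection `f` of the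
vertices of `H` into `G` and, for each edge `ab` of `H`, a path of `G` from `f a` to `f b`
of length at least one and at most `n`, these paths being pairwise vertex-disjoint except
for their ends (branch vertices). -/
def HasNSubdivision {V W : Type*} (G : SimpleGraph V) (H : SimpleGraph W) (n : ℕ) : Prop :=
  ∃ (f : W → V) (P : ∀ ⦃a b : W⦄, H.Adj a b → G.Walk (f a) (f b)),
    Function.Injective f ∧
    (∀ a b (h : H.Adj a b), (P h).IsPath) ∧
    (∀ a b (h : H.Adj a b), 1 ≤ (P h).length ∧ (P h).length ≤ n) ∧
    (∀ a b (h : H.Adj a b), ∀ x ∈ (P h).support, x ∈ Set.range f → x = f a ∨ x = f b) ∧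
    (∀ a b a' b' (h : H.Adj a b) (h' : H.Adj a' b'), s(a, b) ≠ s(a', b') →
      ∀ x ∈ (P h).support, x ∈ (P h').support → x ∈ Set.range f)


namespace CM

variable {V : Type} {G : SimpleGraph V}

/-- there is a walk of length at most `n` from `u` to `v` -/
def Nr (G : SimpleGraph V) (n : ℕ) (u v : V) : Prop := ∃ w : G.Walk u v, w.length ≤ n

/-- there is a walk inside `U` from `u` to `v` -/
def Con (G : SimpleGraph V) (U : Set V) (u v : V) : Prop :=
  ∃ w : G.Walk u v, ∀ x ∈ w.support, x ∈ U

/-- there is a walk inside `U` from `u` to `v` of length at most `n` -/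
def CW (G : SimpleGraph V) (U : Set V) (n : ℕ) (u v : V) : Prop :=
  ∃ w : G.Walk u v, w.length ≤ n ∧ ∀ x ∈ w.support, x ∈ U

lemma Nr.refl (n : ℕ) (u : V) : Nr G n u u := ⟨.nil, by simp⟩
lemma Nr.symm {n : ℕ} {u v : V} (h : Nr G n u v) : Nr G n v u := by
  obtain ⟨w, hw⟩ := h
  exact ⟨w.reverse, by simpa using hw⟩
lemma Nr.mono {n m : ℕ} {u v : V} (h : Nr G n u v) (hm : n ≤ m) : Nr G m u v := by
  obtain ⟨w, hw⟩ := h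
  exact ⟨w, hw.trans hm⟩
lemma Nr.trans {n m : ℕ} {u v x : V} (h : Nr G n u v) (h2 : Nr G m v x) : Nr G (n + m) u x := by
  obtain ⟨w, hw⟩ := h
  obtain ⟨w2, hw2⟩ := h2
  exact ⟨w.append w2, by simp; omega⟩
lemma Nr.tr {n m k : ℕ} {u v x : V} (h : Nr G n u v) (h2 : Nr G m v x) (hk : n + m ≤ k) :
    Nr G k u x := (h.trans h2).mono hk
lemma Nr.of_adj {u v : V} (h : G.Adj u v) : Nr G 1 u v := ⟨h.toWalk, by simp⟩

lemma Con.refl {U : Set V} {u : V} (h : u ∈ U) : Con G U u u := ⟨.nil, by simpa⟩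
lemma Con.symm {U : Set V} {u v : V} (h : Con G U u v) : Con G U v u := by
  obtain ⟨w, hw⟩ := h
  exact ⟨w.reverse, by simpa using hw⟩
lemma Con.mono {U U' : Set V} {u v : V} (h : Con G U u v) (hm : U ⊆ U') : Con G U' u v := by
  obtain ⟨w, hw⟩ := h
  exact ⟨w, fun x hx => hm (hw x hx)⟩
lemma Con.trans {U : Set V} {u v x : V} (h : Con G U u v) (h2 : Con G U v x) : Con G U u x := by
  obtain ⟨w, hw⟩ := h
  obtain ⟨w2, hw2⟩ := h2
  refine ⟨w.append w2, fun x hx => ?_⟩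
  rw [Walk.mem_support_append_iff] at hx
  exact hx.elim (hw x) (hw2 x)
lemma Con.left {U : Set V} {u v : V} (h : Con G U u v) : u ∈ U := by
  obtain ⟨w, hw⟩ := h
  exact hw _ w.start_mem_support
lemma Con.right {U : Set V} {u v : V} (h : Con G U u v) : v ∈ U := h.symm.left

lemma CW.con {U : Set V} {n : ℕ} {u v : V} (h : CW G U n u v) : Con G U u v := by
  obtain ⟨w, _, hw⟩ := h
  exact ⟨w, hw⟩
lemma CW.nr {U : Set V} {n : ℕ} {u v : V} (h : CW G U n u v) : Nr G n u v := by
  obtain ⟨w, h, hw⟩ := h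
  exact ⟨w, h⟩
lemma CW.refl {U : Set V} {u : V} (n : ℕ) (h : u ∈ U) : CW G U n u u := ⟨.nil, by simp, by simpa⟩
lemma CW.symm {U : Set V} {n : ℕ} {u v : V} (h : CW G U n u v) : CW G U n v u := by
  obtain ⟨w, h, hw⟩ := h
  exact ⟨w.reverse, by simpa using h, by simpa using hw⟩
lemma CW.mono {U U' : Set V} {n m : ℕ} {u v : V} (h : CW G U n u v) (hU : U ⊆ U') (hm : n ≤ m) :
    CW G U' m u v := by
  obtain ⟨w, h, hw⟩ := h
  exact ⟨w, h.trans hm, fun x hx => hU (hw x hx)⟩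
lemma CW.trans {U : Set V} {n m : ℕ} {u v x : V} (h : CW G U n u v) (h2 : CW G U m v x) :
    CW G U (n + m) u x := by
  obtain ⟨w, h, hw⟩ := h
  obtain ⟨w2, h2, hw2⟩ := h2
  refine ⟨w.append w2, by simp; omega, fun x hx => ?_⟩
  rw [Walk.mem_support_append_iff] at hx
  exact hx.elim (hw x) (hw2 x)
lemma CW.left {U : Set V} {n : ℕ} {u v : V} (h : CW G U n u v) : u ∈ U := h.con.left
lemma CW.right {U : Set V} {n : ℕ} {u v : V} (h : CW G U n u v) : v ∈ U := h.con.right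

/-- both halves of a walk at a vertex `z` -/
lemma walk_split [DecidableEq V] {u v z : V} (w : G.Walk u v) (hz : z ∈ w.support) :
    ∃ (w1 : G.Walk u z) (w2 : G.Walk z v), w1.length + w2.length = w.length ∧
      (∀ x ∈ w1.support, x ∈ w.support) ∧ (∀ x ∈ w2.support, x ∈ w.support) := by
  refine ⟨w.takeUntil z hz, w.dropUntil z hz, ?_, fun x hx => w.support_takeUntil_subset_support hz hx,
    fun x hx => w.support_dropUntil_subset_support hz hx⟩
  rw [← Walk.length_append, w.take_spec]

lemma eSetDist_lt_of (G : SimpleGraph V) (A B : Set V) (c : ℕ)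
    (h : ∀ a ∈ A, ∀ b ∈ B, ¬ Nr G c a b) : (c : ℕ∞) < eSetDist G A B := by
  have : ((c + 1 : ℕ) : ℕ∞) ≤ eSetDist G A B := by
    refine le_sInf ?_
    rintro n ⟨a, b, w, ha, hb, rfl⟩
    by_contra hlt
    push Not at hlt
    refine h a ha b hb ⟨w, ?_⟩
    have := Nat.cast_lt.1 hlt
    omega
  refine lt_of_lt_of_le ?_ this
  exact_mod_cast Nat.lt_succ_self c

lemma not_nr_of_eSetDist {A B : Set V} {c : ℕ}
    (h : (c : ℕ∞) < eSetDist G A B) : ∀ a ∈ A, ∀ b ∈ B, ¬ Nr G c a b := by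
  rintro a ha b hb ⟨w, hw⟩
  have : eSetDist G A B ≤ (w.length : ℕ∞) := sInf_le ⟨a, b, w, ha, hb, rfl⟩
  have h2 := lt_of_lt_of_le h this
  have := Nat.cast_lt.1 h2
  omega

lemma eSetDist_le_of_nr {y x : V} {g : ℕ} (h : Nr G g y x) : eSetDist G {y} {x} ≤ (g : ℕ∞) := by
  obtain ⟨w, hw⟩ := h
  refine le_trans (sInf_le ⟨y, x, w, rfl, rfl, rfl⟩) ?_
  exact_mod_cast hw

lemma hasN_mono {W : Type} {H : SimpleGraph W} {n m : ℕ} (h : HasNSubdivision G H n) (hm : n ≤ m) :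
    HasNSubdivision G H m := by
  obtain ⟨f, P, h1, h2, h3, h4, h5⟩ := h
  exact ⟨f, P, h1, h2, fun a b h => ⟨(h3 a b h).1, (h3 a b h).2.trans hm⟩, h4, h5⟩

end CM

namespace CM
variable {V : Type} {G : SimpleGraph V}

/-- a rooted subdivided binary tree of depth `m` inside `U` -/
structure IsTr (G : SimpleGraph V) (L : ℕ) (U : Set V) (m : ℕ) (F : List Bool → V)
    (O : List Bool → Set V) : Prop where
  mem : ∀ l, l.length ≤ m → F l ∈ O l
  sub : ∀ l, l.length ≤ m → O l ⊆ U
  disj : ∀ l l', l.length ≤ m → l'.length ≤ m → ∀ z, z ∈ O l → z ∈ O l' → l = l'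
  edge : ∀ l x, l.length + 1 ≤ m → ∃ q : G.Walk (F l) (F (l ++ [x])), q.length ≤ L ∧
    ∀ z ∈ q.support, z = F l ∨ z ∈ O (l ++ [x])
  rad : ∀ l, l.length ≤ m → ∀ z ∈ O l,
    CW G {y | ∃ l', l'.length ≤ l.length ∧ y ∈ O l'} (l.length * L) (F []) z

lemma IsTr.trunc {L : ℕ} {U : Set V} {m m' : ℕ} {F : List Bool → V} {O : List Bool → Set V}
    (h : IsTr G L U m F O) (hm : m' ≤ m) : IsTr G L U m' F O where
  mem l hl := h.mem l (hl.trans hm)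
  sub l hl := h.sub l (hl.trans hm)
  disj l l' hl hl' := h.disj l l' (hl.trans hm) (hl'.trans hm)
  edge l x hl := h.edge l x (hl.trans hm)
  rad l hl := h.rad l (hl.trans hm)

lemma IsTr.mono {L : ℕ} {U U' : Set V} {m : ℕ} {F : List Bool → V} {O : List Bool → Set V}
    (h : IsTr G L U m F O) (hm : U ⊆ U') : IsTr G L U' m F O where
  mem l hl := h.mem l hl
  sub l hl := (h.sub l hl).trans hm
  disj := h.disj
  edge := h.edge
  rad := h.rad

lemma IsTr.radU {L : ℕ} {U : Set V} {m : ℕ} {F : List Bool → V} {O : List Bool → Set V}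
    (h : IsTr G L U m F O) (l : List Bool) (hl : l.length ≤ m) (z : V) (hz : z ∈ O l) :
    CW G U (m * L) (F []) z := by
  refine (h.rad l hl z hz).mono ?_ (Nat.mul_le_mul_right _ hl)
  rintro y ⟨l', hl', hy⟩
  exact h.sub l' (hl'.trans hl) hy

lemma isTr_single (L : ℕ) {U : Set V} {v : V} (hv : v ∈ U) :
    IsTr G L U 0 (fun _ => v) (fun _ => {v}) where
  mem l hl := rfl
  sub l hl := by simpa using hv
  disj l l' hl hl' := by
    have h1 : l = [] := List.length_eq_zero_iff.1 (by omega)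
    have h2 : l' = [] := List.length_eq_zero_iff.1 (by omega)
    intros; rw [h1, h2]
  edge l x hl := by omega
  rad l hl z hz := by
    have hz : z = v := hz
    subst hz
    exact CW.refl _ ⟨[], by simp, rfl⟩

/-- combined root map -/
def cF (v : V) (F : Bool → List Bool → V) : List Bool → V
  | [] => v
  | b :: l => F b l

/-- combined bag map -/
def cO (v : V) (Q : Bool → Set V) (O : Bool → List Bool → Set V) : List Bool → Set V
  | [] => {v}
  | b :: l => {z | z ∈ O b l ∨ (l = [] ∧ z ∈ Q b ∧ z ≠ v)}

lemma isTr_combine {L m : ℕ} {U U' : Set V} {F : Bool → List Bool → V}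
    {O : Bool → List Bool → Set V} {v : V} (h : ∀ b, IsTr G L U m (F b) (O b))
    (hcross : ∀ l l', l.length ≤ m → l'.length ≤ m → ∀ z, z ∈ O true l → z ∈ O false l' → False)
    (q : ∀ b, G.Walk v (F b [])) (hqL : ∀ b, (q b).length ≤ L)
    (hqU : ∀ b, ∀ z ∈ (q b).support, z ∈ U → z = F b [])
    (hv : v ∉ U) (hqq : ∀ z, z ∈ (q true).support → z ∈ (q false).support → z = v)
    (hU : U ⊆ U') (hqU' : ∀ b, ∀ z ∈ (q b).support, z ∈ U') :
    IsTr G L U' (m + 1) (cF v F) (cO v (fun b => {z | z ∈ (q b).support}) O) := by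
  have hcr : ∀ b b', b ≠ b' → ∀ l l', l.length ≤ m → l'.length ≤ m → ∀ z, z ∈ O b l →
      z ∈ O b' l' → False := by
    intro b b' hb l l' hl hl' z hz hz'
    cases b <;> cases b' <;> simp at hb
    · exact hcross _ _ hl' hl z hz' hz
    · exact hcross _ _ hl hl' z hz hz'
  have hq2 : ∀ b b', b ≠ b' → ∀ z, z ∈ (q b).support → z ∈ (q b').support → z = v := by
    intro b b' hb z hz hz'
    cases b <;> cases b' <;> simp at hb
    · exact hqq z hz' hz
    · exact hqq z hz hz'
  constructor
  · rintro (_ | ⟨b, l⟩) hl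
    · rfl
    · exact Or.inl ((h b).mem l (by simpa using hl))
  · rintro (_ | ⟨b, l⟩) hl z hz
    · have hz : z = v := hz
      subst hz
      exact hqU' true _ (q true).start_mem_support
    · rcases hz with hz | ⟨_, hz, _⟩
      · exact hU ((h b).sub l (by simpa using hl) hz)
      · exact hqU' b z hz
  · rintro (_ | ⟨b, l⟩) (_ | ⟨b', l'⟩) hl hl' z hz hz'
    · rfl
    · have hz : z = v := hz
      subst hz
      rcases hz' with hz' | ⟨_, hz', h'⟩
      · exact (hv ((h b').sub l' (by simpa using hl') hz')).elim
      · exact (h' rfl).elim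
    · have hz' : z = v := hz'
      subst hz'
      rcases hz with hz | ⟨_, hz, h'⟩
      · exact (hv ((h b).sub l (by simpa using hl) hz)).elim
      · exact (h' rfl).elim
    · replace hl : l.length ≤ m := by simpa using hl
      replace hl' : l'.length ≤ m := by simpa using hl'
      by_cases hb : b = b'
      · subst hb
        congr 1
        rcases hz with hz | ⟨hle, hz, hzv⟩
        · rcases hz' with hz' | ⟨hle', hz', hzv'⟩
          · exact (h b).disj l l' hl hl' z hz hz'
          · have := hqU b z hz' ((h b).sub l hl hz)
            subst this
            rw [hle']
            exact (h b).disj l [] hl (by simp) _ hz ((h b).mem [] (by simp))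
        · rcases hz' with hz' | ⟨hle', hz', hzv'⟩
          · have := hqU b z hz ((h b).sub l' hl' hz')
            subst this
            rw [hle]
            exact (h b).disj [] l' (by simp) hl' _ ((h b).mem [] (by simp)) hz'
          · rw [hle, hle']
      · exfalso
        rcases hz with hz | ⟨hle, hz, hzv⟩
        · rcases hz' with hz' | ⟨hle', hz', hzv'⟩
          · exact hcr b b' hb l l' hl hl' z hz hz'
          · have := hqU b' z hz' ((h b).sub l hl hz)
            subst this
            exact hcr b b' hb l [] hl (by simp) _ hz ((h b').mem [] (by simp))
        · rcases hz' with hz' | ⟨hle', hz', hzv'⟩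
          · have := hqU b z hz ((h b').sub l' hl' hz')
            subst this
            exact hcr b b' hb [] l' (by simp) hl' _ ((h b).mem [] (by simp)) hz'
          · exact hzv (hq2 b b' hb z hz hz')
  · rintro (_ | ⟨b, l⟩) x hl
    · refine ⟨q x, hqL x, fun z hz => ?_⟩
      by_cases hzv : z = v
      · exact Or.inl hzv
      · exact Or.inr (Or.inr ⟨rfl, hz, hzv⟩)
    · obtain ⟨q', h1, h2⟩ := (h b).edge l x (by simpa using hl)
      refine ⟨q', h1, fun z hz => ?_⟩
      rcases h2 z hz with h3 | h3
      · exact Or.inl h3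
      · exact Or.inr (Or.inl h3)
  · rintro (_ | ⟨b, l⟩) hl z hz
    · have hz : z = v := hz
      subst hz
      exact CW.refl _ ⟨[], by simp, rfl⟩
    · have hl : l.length ≤ m := by simpa using hl
      have hsup : ∀ y ∈ (q b).support, y ∈ {y | ∃ l', l'.length ≤ (b :: l).length ∧
          y ∈ cO v (fun b => {z | z ∈ (q b).support}) O l'} := by
        intro y hy
        by_cases hyv : y = v
        · exact ⟨[], by simp, hyv⟩
        · exact ⟨[b], by simp, Or.inr ⟨rfl, hy, hyv⟩⟩
      rcases hz with hz | ⟨hle, hz, hzv⟩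
      · have h1 := (h b).rad l hl z hz
        have h2 : CW G {y | ∃ l', l'.length ≤ (b :: l).length ∧
          y ∈ cO v (fun b => {z | z ∈ (q b).support}) O l'} L v (F b []) := ⟨q b, hqL b, hsup⟩
        have h3 := h2.trans (h1.mono (U' := {y | ∃ l', l'.length ≤ (b :: l).length ∧
          y ∈ cO v (fun b => {z | z ∈ (q b).support}) O l'}) (by
            rintro y ⟨l', hl', hy⟩
            exact ⟨b :: l', by simpa using hl', Or.inl hy⟩) le_rfl)
        refine h3.mono subset_rfl ?_
        simp only [List.length_cons]
        ring_nf
        exact le_rfl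
      · classical
        obtain ⟨w1, w2, hw, hw1, hw2⟩ := walk_split (q b) hz
        refine ⟨w1, ?_, fun x hx => hsup x (hw1 x hx)⟩
        have := hqL b
        subst hle
        show w1.length ≤ ([b] : List Bool).length * L
        simp only [List.length_singleton, one_mul]
        omega

lemma IsTr.hasSub {L : ℕ} {U : Set V} {m d : ℕ} {F : List Bool → V} {O : List Bool → Set V}
    (h : IsTr G L U m F O) (hm : d ≤ m + 1) : HasNSubdivision G (binTree d) L := by
  classical
  set f : {l : List Bool // l.length < d} → V := fun a => F a.1.reverse with hf
  have hlen : ∀ a : {l : List Bool // l.length < d}, a.1.reverse.length ≤ m := by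
    intro a
    have := a.2
    simp
    omega
  have hO : ∀ a, f a ∈ O a.1.reverse := fun a => h.mem _ (hlen a)
  have hinj : ∀ a b : {l : List Bool // l.length < d}, ∀ z, z ∈ O a.1.reverse → z ∈ O b.1.reverse → a = b := by
    intro a b z ha hb
    have := h.disj _ _ (hlen a) (hlen b) z ha hb
    exact Subtype.ext (List.reverse_injective this)
  have hfi : Function.Injective f := by
    intro a b hab
    exact hinj a b (f a) (hO a) (hab ▸ hO b)
  have key : ∀ a b, (binTree d).Adj a b → ∃ P : G.Walk (f a) (f b), P.IsPath ∧ P.length ≤ L ∧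
      ∃ e e', ((e = a ∧ e' = b) ∨ (e = b ∧ e' = a)) ∧ (∃ x, e'.1 = x :: e.1) ∧
        ∀ z ∈ P.support, z = f e ∨ z ∈ O e'.1.reverse := by
    have one : ∀ a b : {l : List Bool // l.length < d}, (∃ x, b.1 = x :: a.1) →
        ∃ P : G.Walk (f a) (f b), P.IsPath ∧ P.length ≤ L ∧
          ∀ z ∈ P.support, z = f a ∨ z ∈ O b.1.reverse := by
      rintro a b ⟨x, hx⟩
      have hb : b.1.reverse = a.1.reverse ++ [x] := by rw [hx]; simp
      obtain ⟨q, hq, hq2⟩ := h.edge a.1.reverse x (by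
        have := hlen b
        rw [hb] at this
        simpa using this)
      have hfb : f b = F (a.1.reverse ++ [x]) := by rw [hf]; simp only [hb]
      rw [hfb, hb]
      exact ⟨q.bypass, q.bypass_isPath, (q.length_bypass_le_length).trans hq,
        fun z hz => hq2 z (q.support_bypass_subset_support hz)⟩
    intro a b hab
    rcases hab.2 with hx | hx
    · obtain ⟨P, h1, h2, h3⟩ := one a b hx
      exact ⟨P, h1, h2, a, b, Or.inl ⟨rfl, rfl⟩, hx, h3⟩
    · obtain ⟨P, h1, h2, h3⟩ := one b a hx
      exact ⟨P.reverse, h1.reverse, by simpa using h2, b, a, Or.inr ⟨rfl, rfl⟩, hx, by simpa using h3⟩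
  choose P h1 h2 e e' h3 h4 h5 using key
  refine ⟨f, fun a b h => P a b h, hfi, fun a b h => h1 a b h, fun a b h => ⟨?_, h2 a b h⟩, ?_, ?_⟩
  · by_contra hlt
    have h0 : (P a b h).length = 0 := Nat.lt_one_iff.1 (not_le.1 hlt)
    exact h.ne (hfi (Walk.eq_of_length_eq_zero h0))
  · rintro a b h x hx ⟨y, rfl⟩
    rcases h5 a b h _ hx with hy | hy
    · rw [hy]
      rcases h3 a b h with h' | h'
      · exact Or.inl (by rw [h'.1])
      · exact Or.inr (by rw [h'.1])
    · have := hinj y (e' a b h) _ (hO y) hy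
      rw [this]
      rcases h3 a b h with h' | h'
      · exact Or.inr (by rw [h'.2])
      · exact Or.inl (by rw [h'.2])
  · intro a b a' b' h h' hne x hx hx'
    rcases h5 a b h _ hx with hy | hy
    · exact ⟨_, hy.symm⟩
    rcases h5 a' b' h' _ hx' with hy' | hy'
    · exact ⟨_, hy'.symm⟩
    exfalso
    have h6 := hinj _ _ x hy hy'
    have h7 : e a b h = e a' b' h' := by
      obtain ⟨x, hx⟩ := h4 a b h
      obtain ⟨x', hx'⟩ := h4 a' b' h'
      rw [← h6, hx] at hx'
      simp at hx'
      exact Subtype.ext hx'.2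
    have h8 : ∀ a b (h : (binTree d).Adj a b), s(a, b) = s(e a b h, e' a b h) := by
      intro a b h
      rcases h3 a b h with h' | h'
      · rw [h'.1, h'.2]
      · rw [h'.1, h'.2, Sym2.eq_swap]
    apply hne
    rw [h8 a b h, h8 a' b' h', h6, h7]

end CM

namespace CM
variable {V : Type} {G : SimpleGraph V}

/-- admissible extension of `Y` -/
def Good (G : SimpleGraph V) (L : ℕ) (Y U : Set V) : Prop :=
  Y ⊆ U ∧ ∀ v ∈ U, ∃ m F O, IsTr G L U m F O ∧ F [] = v ∧ ∃ y ∈ Y, Nr G (L * m) v y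

lemma path_halves [DecidableEq V] {u v z : V} (w : G.Walk u v) (hp : w.IsPath) (hz : z ∈ w.support)
    (x : V) (h1 : x ∈ (w.takeUntil z hz).support) (h2 : x ∈ (w.dropUntil z hz).support) : x = z := by
  by_contra hne
  have h3 : x ∈ (w.dropUntil z hz).support.tail := by
    rw [Walk.mem_support_iff] at h2
    exact h2.resolve_left hne
  have := hp.support_nodup
  rw [← w.take_spec hz, Walk.support_append, List.nodup_append] at this
  exact this.2.2 x h1 x h3 rfl

theorem good_ext {L : ℕ} {Y U : Set V} (hU : Good G L Y U)
    {u u' : V} (Γ : G.Walk u u') (hp : Γ.IsPath) (hΓL : Γ.length ≤ L)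
    (hint : ∀ z ∈ Γ.support, z ∈ U → z = u ∨ z = u')
    {m m' : ℕ} {F F' : List Bool → V} {O O' : List Bool → Set V}
    (h : IsTr G L U m F O) (h' : IsTr G L U m' F' O') (hF : F [] = u) (hF' : F' [] = u')
    (hy : ∃ y ∈ Y, Nr G (L * m) u y) (hy' : ∃ y ∈ Y, Nr G (L * m') u' y)
    (hcross : ∀ l l', l.length ≤ min m m' → l'.length ≤ min m m' → ∀ z, z ∈ O l → z ∈ O' l' → False) :
    Good G L Y (U ∪ {z | z ∈ Γ.support}) := by
  classical
  subst hF hF'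
  refine ⟨hU.1.trans Set.subset_union_left, fun v hv => ?_⟩
  by_cases hvU : v ∈ U
  · obtain ⟨m, F, O, h1, h2⟩ := hU.2 v hvU
    exact ⟨m, F, O, h1.mono Set.subset_union_left, h2⟩
  have hvs : v ∈ Γ.support := hv.resolve_left hvU
  set q1 := (Γ.takeUntil v hvs).reverse with hq1
  set q2 := Γ.dropUntil v hvs with hq2
  have hlen : (Γ.takeUntil v hvs).length + q2.length = Γ.length := by
    rw [hq2, ← Walk.length_append, Γ.take_spec]
  have hs1 : ∀ z ∈ q1.support, z ∈ Γ.support := by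
    intro z hz
    rw [hq1, Walk.support_reverse, List.mem_reverse] at hz
    exact Γ.support_takeUntil_subset_support hvs hz
  have hs2 : ∀ z ∈ q2.support, z ∈ Γ.support := by
    intro z hz
    exact Γ.support_dropUntil_subset_support hvs hz
  have hhalf : ∀ z, z ∈ q1.support → z ∈ q2.support → z = v := by
    intro z hz hz'
    rw [hq1, Walk.support_reverse, List.mem_reverse] at hz
    exact path_halves Γ hp hvs z hz hz'
  have hl1 : q1.length ≤ L := by rw [hq1, Walk.length_reverse]; omega
  have hl2 : q2.length ≤ L := by omega
  have hvu : v ≠ F [] := fun he => hvU (he ▸ h.sub [] (by simp) (h.mem [] (by simp)))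
  have hvu' : v ≠ F' [] := fun he => hvU (he ▸ h'.sub [] (by simp) (h'.mem [] (by simp)))
  refine ⟨min m m' + 1, _, _, isTr_combine (m := min m m') (U := U) (v := v)
    (F := fun b => bif b then F else F') (O := fun b => bif b then O else O') ?_ ?_
    (fun b => match b with
      | true => q1
      | false => q2) ?_ ?_ hvU ?_ Set.subset_union_left ?_, rfl, ?_⟩
  · intro b
    cases b
    · exact h'.trunc (min_le_right _ _)
    · exact h.trunc (min_le_left _ _)
  · exact hcross
  · intro b
    cases b
    · exact hl2
    · exact hl1
  · intro b z hz hzU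
    cases b
    · rcases hint z (hs2 z hz) hzU with h1 | h1
      · have := hhalf z (h1 ▸ q1.end_mem_support) hz
        exact (hvu (this.symm.trans h1)).elim
      · exact h1
    · rcases hint z (hs1 z hz) hzU with h1 | h1
      · exact h1
      · have := hhalf z hz (h1 ▸ q2.end_mem_support)
        exact (hvu' (this.symm.trans h1)).elim
  · exact hhalf
  · intro b z hz
    cases b
    · exact Or.inr (hs2 z hz)
    · exact Or.inr (hs1 z hz)
  · rcases le_total m m' with hmm | hmm
    · obtain ⟨y, hy, hn⟩ := hy
      refine ⟨y, hy, ?_⟩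
      rw [min_eq_left hmm]
      refine Nr.tr (⟨q1, hl1⟩ : Nr G L v (F [])) hn ?_
      rw [mul_add]; omega
    · obtain ⟨y, hy, hn⟩ := hy'
      refine ⟨y, hy, ?_⟩
      rw [min_eq_right hmm]
      refine Nr.tr (⟨q2, hl2⟩ : Nr G L v (F' [])) hn ?_
      rw [mul_add]; omega

theorem hull [Finite V] {d L : ℕ} (hN : ¬ HasNSubdivision G (binTree d) L) (Y : Set V) :
    ∃ U : Set V, Y ⊆ U ∧ (∀ v ∈ U, ∃ y ∈ Y, Nr G (d * L) v y) ∧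
      ∀ x ∈ U, ∀ y ∈ U, Nr G L x y → CW G U (L * (2 * d * L + 1)) x y := by
  classical
  obtain ⟨U, -, hmax⟩ := (Set.toFinite {U | Good G L Y U}).exists_le_maximal (a := Y)
    ⟨subset_rfl, fun v hv => ⟨0, _, _, isTr_single L hv, rfl, v, hv, Nr.refl _ _⟩⟩
  have hU : Good G L Y U := hmax.1
  have hmd : ∀ {m F O}, IsTr G L U m F O → m ≤ d := by
    intro m F O h
    by_contra hlt
    exact hN (h.hasSub (by omega))
  refine ⟨U, hU.1, ?_, ?_⟩
  · intro v hv
    obtain ⟨m, F, O, h1, h2, y, hy, hn⟩ := hU.2 v hv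
    exact ⟨y, hy, hn.mono (by rw [mul_comm]; exact Nat.mul_le_mul_right _ (hmd h1))⟩
  have key : ∀ n, n ≤ L → ∀ x y (w : G.Walk x y), w.length = n → x ∈ U → y ∈ U →
      CW G U (n * (2 * d * L + 1)) x y := by
    intro n
    induction n using Nat.strong_induction_on with
    | _ n ih =>
    intro hnL x y w hw hx hy
    by_cases hz : ∃ z ∈ w.support, z ∈ U ∧ z ≠ x ∧ z ≠ y
    · obtain ⟨z, hz, hzU, hzx, hzy⟩ := hz
      obtain ⟨w1, w2, hlen, -, -⟩ := walk_split w hz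
      have h1 : w1.length ≠ 0 := fun h => hzx (Walk.eq_of_length_eq_zero h).symm
      have h2 : w2.length ≠ 0 := fun h => hzy (Walk.eq_of_length_eq_zero h)
      have := (ih w1.length (by omega) (by omega) x z w1 rfl hx hzU).trans
        (ih w2.length (by omega) (by omega) z y w2 rfl hzU hy)
      rwa [← add_mul, hlen, hw] at this
    push Not at hz
    by_cases hn : n = 0
    · subst hn
      have := Walk.eq_of_length_eq_zero hw
      subst this
      exact CW.refl _ hx
    set Γ := w.bypass with hΓ
    have hp : Γ.IsPath := w.bypass_isPath
    have hl : Γ.length ≤ n := hw ▸ w.length_bypass_le_length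
    by_cases hall : ∀ z ∈ Γ.support, z ∈ U
    · refine ⟨Γ, hl.trans ?_, hall⟩
      exact Nat.le_mul_of_pos_right _ (by omega)
    obtain ⟨m, F, O, h1, h2, hyy⟩ := hU.2 x hx
    obtain ⟨m', F', O', h1', h2', hyy'⟩ := hU.2 y hy
    by_cases hcross : ∀ l l', l.length ≤ min m m' → l'.length ≤ min m m' → ∀ z, z ∈ O l →
        z ∈ O' l' → False
    · exfalso
      have := good_ext hU Γ hp (hl.trans hnL) (by
        intro z hz1 hz2
        have := hz z (w.support_bypass_subset_support hz1) hz2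
        tauto) h1 h1' h2 h2' hyy hyy' hcross
      have h3 := hmax.2 (y := U ∪ {z | z ∈ Γ.support}) this Set.subset_union_left
      exact hall fun z hz => h3 (Or.inr hz)
    · push Not at hcross
      obtain ⟨l, l', hl, hl', z, hz, hz', -⟩ := hcross
      have h3 := h1.radU l (hl.trans (min_le_left _ _)) z hz
      have h4 := h1'.radU l' (hl'.trans (min_le_right _ _)) z hz'
      rw [h2] at h3
      rw [h2'] at h4
      refine (h3.trans h4.symm).mono subset_rfl ?_
      have e1 : m * L ≤ d * L := Nat.mul_le_mul_right _ (hmd h1)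
      have e2 : m' * L ≤ d * L := Nat.mul_le_mul_right _ (hmd h1')
      have e3 : 1 * (2 * d * L + 1) ≤ n * (2 * d * L + 1) := Nat.mul_le_mul_right _ (by omega)
      nlinarith
  intro x hx y hy ⟨w, hw⟩
  exact (key w.length hw x y w rfl hx hy).mono subset_rfl (Nat.mul_le_mul_right _ hw)

end CM

namespace CM
variable {V : Type} {G : SimpleGraph V}

/-- a system of `K` tight parallel rails -/
structure Rails (G : SimpleGraph V) (S T : Set V) (K Lr D : ℕ) (n : Fin K → ℕ)
    (p : Fin K → ℕ → V) : Prop where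
  start : ∀ i, p i 0 ∈ S
  fin : ∀ i, p i (n i) ∈ T
  adj : ∀ i a, a < n i → G.Adj (p i a) (p i (a + 1))
  rp : ∀ i j a b, a ≤ n i → b ≤ n j → Nr G Lr (p i a) (p j b) → i = j ∧ a ≤ b + D ∧ b ≤ a + D

lemma exists_tight (U : Set V) {u v : V} (hc : Con G U u v) :
    ∃ w : G.Walk u v, (∀ x ∈ w.support, x ∈ U) ∧
      ∀ a b D, a ≤ w.length → b ≤ w.length → CW G U D (w.getVert a) (w.getVert b) → b ≤ a + D := by
  classical
  have hex : ∃ n, ∃ w : G.Walk u v, w.length = n ∧ ∀ x ∈ w.support, x ∈ U := by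
    obtain ⟨w, hw⟩ := hc
    exact ⟨_, w, rfl, hw⟩
  obtain ⟨w, hw, hU⟩ := Nat.find_spec hex
  refine ⟨w, hU, ?_⟩
  rintro a b D ha hb ⟨q, hq, hqU⟩
  have hmin := Nat.find_min' hex ⟨((w.take a).append q).append (w.drop b), rfl, by
    intro x hx
    rw [Walk.mem_support_append_iff, Walk.mem_support_append_iff] at hx
    rcases hx with (hx | hx) | hx
    · exact hU x ((w.isSubwalk_take a).support_subset hx)
    · exact hqU x hx
    · exact hU x ((w.isSubwalk_drop b).support_subset hx)⟩
  rw [← hw, Walk.length_append, Walk.length_append, Walk.take_length, Walk.drop_length] at hmin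
  omega

theorem exists_rails [Finite V] {d L K : ℕ} (hN : ¬ HasNSubdivision G (binTree d) L) {S T : Set V}
    (u v : Fin K → V) (P : ∀ i, G.Walk (u i) (v i)) (hu : ∀ i, u i ∈ S) (hv : ∀ i, v i ∈ T)
    (hfar : ∀ i j, i ≠ j → ∀ x ∈ (P i).support, ∀ y ∈ (P j).support, ¬ Nr G (L + 2 * d * L) x y) :
    ∃ n p, Rails G S T K L (L * (2 * d * L + 1)) n p := by
  have h1 := fun i => hull hN {x | x ∈ (P i).support}
  choose U hU1 hU2 hU3 using h1
  have h2 : ∀ i, _ := fun i => exists_tight (U i) (u := u i) (v := v i) ⟨P i, fun x hx => hU1 i hx⟩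
  choose w hw1 hw2 using h2
  refine ⟨fun i => (w i).length, fun i a => (w i).getVert a, ?_, ?_, ?_, ?_⟩
  · intro i; simpa using hu i
  · intro i; simpa using hv i
  · intro i a ha
    exact (w i).adj_getVert_succ ha
  · intro i j a b ha hb hn
    have hai : (w i).getVert a ∈ U i := hw1 i _ ((w i).getVert_mem_support a)
    have hbj : (w j).getVert b ∈ U j := hw1 j _ ((w j).getVert_mem_support b)
    by_cases hij : i = j
    · subst hij
      have h3 := hU3 i _ hai _ hbj hn
      exact ⟨rfl, hw2 i b a _ hb ha h3.symm, hw2 i a b _ ha hb h3⟩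
    · exfalso
      obtain ⟨x, hx, hx2⟩ := hU2 i _ hai
      obtain ⟨y, hy, hy2⟩ := hU2 j _ hbj
      refine hfar i j hij x hx y hy ((hx2.symm.trans hn).tr hy2 ?_)
      have : 2 * d * L = d * L + d * L := by ring
      omega

end CM

namespace CM
variable {V : Type} {G : SimpleGraph V}

/-- `u` is `v` or in the same component of `W` -/
def Cl (G : SimpleGraph V) (W : Set V) (v u : V) : Prop := u = v ∨ Con G W v u

lemma Cl.refl (W : Set V) (v : V) : Cl G W v v := Or.inl rfl
lemma Cl.of_con {W : Set V} {u v x : V} (h : Con G W u v) (h2 : Cl G W v x) : Cl G W u x := by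
  rcases h2 with rfl | h2
  · exact Or.inr h
  · exact Or.inr (h.trans h2)
lemma Cl.con {W : Set V} {u v : V} (h : Cl G W u v) (hu : u ∈ W) : Con G W u v := by
  rcases h with rfl | h
  · exact Con.refl hu
  · exact h
lemma Cl.con' {W : Set V} {u v : V} (h : Cl G W u v) (hu : v ∈ W) : Con G W u v := by
  rcases h with rfl | h
  · exact Con.refl hu
  · exact h
lemma Cl.eq_of_not {W : Set V} {u v : V} (h : Cl G W u v) (hu : u ∉ W) : v = u := by
  rcases h with rfl | h
  · rfl
  · exact (hu h.left).elim

/-- jump relation -/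
def J (G : SimpleGraph V) (W : Set V) {K : ℕ} (n : Fin K → ℕ) (p : Fin K → ℕ → V) (ρ C : ℕ)
    (u v : V) : Prop :=
  ∃ i y x, y ≤ n i ∧ x + C ≤ y ∧ ∃ o e, Cl G W u o ∧ Nr G ρ o (p i y) ∧ Cl G W v e ∧
    Nr G ρ e (p i x)

/-- `v` is the same as a vertex of `S`, up to components of `W` -/
def Tch (G : SimpleGraph V) (W S : Set V) (v : V) : Prop := ∃ s ∈ S, Cl G W v s

/-- chain of jumps -/
structure IsCh (G : SimpleGraph V) (W S : Set V) {K : ℕ} (n : Fin K → ℕ) (p : Fin K → ℕ → V)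
    (ρ C m : ℕ) (a : ℕ → V) : Prop where
  st : Tch G W S (a 0)
  jump : ∀ s, s < m → J G W n p ρ C (a s) (a (s + 1))
  int : ∀ s, 0 < s → s < m → a s ∈ W

/-- complete chain of jumps -/
structure IsFull (G : SimpleGraph V) (W S T : Set V) {K : ℕ} (n : Fin K → ℕ) (p : Fin K → ℕ → V)
    (ρ C m : ℕ) (a : ℕ → V) : Prop extends IsCh G W S n p ρ C m a where
  fin : Tch G W T (a m)
  zero : m = 0 → a 0 ∈ W

variable {W S T : Set V} {K : ℕ} {n : Fin K → ℕ} {p : Fin K → ℕ → V} {ρ C : ℕ}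

lemma ch_succ {m : ℕ} {a : ℕ → V} (h : IsCh G W S n p ρ C m a) (hw : a m ∈ W ∨ m = 0) {v : V}
    (hj : J G W n p ρ C (a m) v) :
    IsCh G W S n p ρ C (m + 1) (fun s => if s ≤ m then a s else v) where
  st := by simpa using h.st
  jump s hs := by
    rcases Nat.lt_succ_iff_lt_or_eq.1 hs with h1 | rfl
    · have := h.jump s h1
      simp only [if_pos h1.le, if_pos (Nat.succ_le_of_lt h1)]
      exact this
    · simpa using hj
  int s h0 hs := by
    simp only [if_pos (Nat.le_of_lt_succ hs)]
    rcases Nat.lt_succ_iff_lt_or_eq.1 hs with h1 | rfl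
    · exact h.int s h0 h1
    · exact hw.resolve_right (by omega)

lemma J.con_right {u v v' : V} (h : J G W n p ρ C u v) (hc : Con G W v' v) :
    J G W n p ρ C u v' := by
  obtain ⟨i, y, x, h1, h2, o, e, h3, h4, h5, h6⟩ := h
  exact ⟨i, y, x, h1, h2, o, e, h3, h4, Cl.of_con hc h5, h6⟩

lemma rail_nr {Lr D : ℕ} (hR : Rails G S T K Lr D n p) (i : Fin K) (a b : ℕ) (hab : a ≤ b)
    (hb : b ≤ n i) : Nr G (b - a) (p i a) (p i b) := by
  induction b, hab using Nat.le_induction with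
  | base => exact Nr.refl _ _
  | succ b hab ih =>
    exact (ih (by omega)).tr (Nr.of_adj (hR.adj i b (by omega))) (by omega)

theorem cut {Lr D r B : ℕ} (hR : Rails G S T K Lr D n p)
    (hcov : ∀ v, v ∉ W → ∃ i a, a ≤ n i ∧ Nr G r v (p i a))
    (hρ : ρ = r + 1) (hL : 2 * r + 1 ≤ Lr) (hCB : C ≤ B) (hDB : D ≤ B)
    (hno : ∀ m a, ¬ IsFull G W S T n p ρ C m a) :
    ∃ x : Fin K → ℕ, ∀ s t (w : G.Walk s t), s ∈ S → t ∈ T →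
      ∃ y ∈ w.support, ∃ i, Nr G (r + B) y (p i (x i)) := by
  classical
  set Rch : V → Prop := fun v => v ∈ W ∧ ∃ m a, IsCh G W S n p ρ C m a ∧ a m = v with hRch
  set Src : V → Prop := fun u => Rch u ∨ u ∈ S with hSrc
  have src_ch : ∀ u, Src u → ∃ m a, IsCh G W S n p ρ C m a ∧ a m = u ∧ (a m ∈ W ∨ m = 0) := by
    rintro u (⟨h1, m, a, h2, h3⟩ | h1)
    · exact ⟨m, a, h2, h3, Or.inl (h3 ▸ h1)⟩
    · exact ⟨0, fun _ => u, ⟨⟨u, h1, Cl.refl _ _⟩, by simp, by simp⟩, rfl, Or.inr rfl⟩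
  set Q : Fin K → ℕ → Prop := fun i y => ∃ u o, Src u ∧ Cl G W u o ∧ Nr G ρ o (p i y) with hQ
  have hmax : ∀ i, ∃ x, x ≤ n i ∧ Q i x ∧ ∀ y, y ≤ n i → Q i y → y ≤ x := by
    intro i
    have h0 : Q i 0 := ⟨p i 0, p i 0, Or.inr (hR.start i), Cl.refl _ _, Nr.refl _ _⟩
    refine ⟨Nat.findGreatest (Q i) (n i), Nat.findGreatest_le _, ?_, ?_⟩
    · exact Nat.findGreatest_spec (P := Q i) (Nat.zero_le _) h0
    · intro y hy hq
      exact Nat.le_findGreatest hy hq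
  choose x hx1 hx2 hx3 using hmax
  refine ⟨x, ?_⟩
  set Inv : V → Prop := fun q => Rch q ∨ ∃ i y, Nr G r q (p i y) ∧ y + B ≤ x i with hInv
  have left_of : ∀ q i y, Nr G r q (p i y) → y ≤ x i → ¬ Nr G (r + B) q (p i (x i)) → Inv q := by
    intro q i y h1 h2 h3
    right
    refine ⟨i, y, h1, ?_⟩
    by_contra hlt
    exact h3 (h1.tr (rail_nr hR i y (x i) h2 (hx1 i)) (by omega))
  have jump_left : ∀ q i y v, Nr G r q (p i y) → y + B ≤ x i → Nr G 1 v q →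
      ∃ u, Src u ∧ J G W n p ρ C u v := by
    intro q i y v h1 h2 h3
    obtain ⟨u, o, h4, h5, h6⟩ := hx2 i
    exact ⟨u, h4, i, x i, y, hx1 i, by omega, o, v, h5, h6, Cl.refl _ _, h3.tr h1 (by omega)⟩
  have main : ∀ q t (w : G.Walk q t), t ∈ T → (∀ y ∈ w.support, ∀ i, ¬ Nr G (r + B) y (p i (x i))) →
      Inv q → False := by
    intro q t w ht
    induction w with
    | nil =>
      rename_i q
      intro hav hinv
      rcases hinv with ⟨h1, m, a, h2, h3⟩ | ⟨i, y, h1, h2⟩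
      · refine hno m a ⟨h2, ⟨q, ht, h3 ▸ Cl.refl _ _⟩, ?_⟩
        rintro rfl
        exact h3 ▸ h1
      · obtain ⟨u, h4, h5⟩ := jump_left q i y q h1 h2 (Nr.refl _ _)
        obtain ⟨m, a, h6, rfl, h7⟩ := src_ch u h4
        refine hno (m + 1) _ ⟨ch_succ h6 h7 h5, ⟨q, ht, ?_⟩, by simp⟩
        simp only [Nat.succ_le_iff, lt_irrefl, if_false]
        exact Cl.refl _ _
    | cons hadj w ih =>
      rename_i q q' t
      intro hav hinv
      refine ih ht (fun y hy => hav y (by simp [hy])) ?_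
      have hav' := hav q' (by simp)
      by_cases hq' : q' ∈ W
      · left
        rcases hinv with ⟨h1, m, a, h2, h3⟩ | ⟨i, y, h1, h2⟩
        · have hcon : Con G W q' q := ⟨hadj.symm.toWalk, by simp [hq', h1]⟩
          refine ⟨hq', ?_⟩
          rcases Nat.eq_zero_or_pos m with rfl | hm
          · refine ⟨0, fun _ => q', ⟨?_, by simp, by simp⟩, rfl⟩
            obtain ⟨s, hs, hs2⟩ := h2.st
            exact ⟨s, hs, Cl.of_con hcon (h3 ▸ hs2)⟩
          · obtain ⟨m, rfl⟩ : ∃ k, m = k + 1 := ⟨m - 1, by omega⟩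
            have hj := h2.jump m (by omega)
            rw [h3] at hj
            refine ⟨m + 1, _, ch_succ (m := m) (a := a) ⟨h2.st, fun s hs => h2.jump s (by omega),
              fun s h0 hs => h2.int s h0 (by omega)⟩ ?_ (hj.con_right hcon), by simp⟩
            by_cases hm0 : m = 0
            · exact Or.inr hm0
            · exact Or.inl (h2.int m (by omega) (by omega))
        · obtain ⟨u, h4, h5⟩ := jump_left q i y q' h1 h2 (Nr.of_adj hadj.symm)
          obtain ⟨m, a, h6, rfl, h7⟩ := src_ch u h4
          exact ⟨hq', m + 1, _, ch_succ h6 h7 h5, by simp⟩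
      · obtain ⟨i, a, ha, hn⟩ := hcov q' hq'
        refine left_of q' i a hn ?_ (hav' i)
        rcases hinv with h1 | ⟨j, y, h1, h2⟩
        · exact hx3 i a ha ⟨q, q, Or.inl h1, Cl.refl _ _, (Nr.of_adj hadj).tr hn (by omega)⟩
        · have := hR.rp i j a y ha (by have := hx1 j; omega)
            ((hn.symm.trans (Nr.of_adj hadj.symm)).tr h1 (by omega))
          obtain ⟨rfl, h3, h4⟩ := this
          omega
  intro s t w hs ht
  by_contra hcon
  push Not at hcon
  refine main s t w ht hcon ?_
  by_cases hsW : s ∈ W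
  · exact Or.inl ⟨hsW, 0, fun _ => s, ⟨⟨s, hs, Cl.refl _ _⟩, by simp, by simp⟩, rfl⟩
  · obtain ⟨i, a, ha, hn⟩ := hcov s hsW
    exact left_of s i a hn (hx3 i a ha ⟨s, s, Or.inr hs, Cl.refl _ _, hn.mono (by omega)⟩)
      (hcon s w.start_mem_support i)

theorem min_full (hex : ∃ m a, IsFull G W S T n p ρ C m a) :
    ∃ m a, IsFull G W S T n p ρ C m a ∧
      (∀ s u, s + 2 ≤ u → u ≤ m → ¬ J G W n p ρ C (a s) (a u)) ∧
      (∀ s u, s < u → u ≤ m → a s ∈ W → a u ∈ W → ¬ Con G W (a s) (a u)) := by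
  classical
  obtain ⟨a, ha⟩ := Nat.find_spec hex
  set m := Nat.find hex with hm
  have hmin : ∀ m' a', IsFull G W S T n p ρ C m' a' → m ≤ m' := fun m' a' h =>
    Nat.find_min' hex ⟨a', h⟩
  refine ⟨m, a, ha, ?_, ?_⟩
  · intro s u hsu hum hJ
    have := hmin (m - (u - s - 1)) (fun t => if t ≤ s then a t else a (t + (u - s - 1)))
      { st := by simpa using ha.st
        jump := by
          intro t ht
          rcases lt_trichotomy t s with h | h | h
          · simp only [if_pos h.le, if_pos (Nat.succ_le_of_lt h)]
            exact ha.jump t (by omega)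
          · subst h
            simp only [le_refl, if_true, Nat.succ_le_iff, lt_irrefl, if_false]
            have : t + 1 + (u - t - 1) = u := by omega
            rw [this]
            exact hJ
          · simp only [if_neg (not_le.2 h), if_neg (show ¬ t + 1 ≤ s by omega)]
            have := ha.jump (t + (u - s - 1)) (by omega)
            rwa [show t + 1 + (u - s - 1) = t + (u - s - 1) + 1 by omega]
        int := by
          intro t h0 ht
          by_cases h : t ≤ s
          · simp only [if_pos h]
            exact ha.int t h0 (by omega)
          · simp only [if_neg h]
            exact ha.int _ (by omega) (by omega)
        fin := by
          simp only [if_neg (show ¬ m - (u - s - 1) ≤ s by omega)]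
          rw [show m - (u - s - 1) + (u - s - 1) = m by omega]
          exact ha.fin
        zero := by intro h; omega }
    omega
  · intro s u hsu hum hs hu hcon
    have := hmin (m - (u - s)) (fun t => if t < s then a t else a (t + (u - s)))
      { st := by
          by_cases h : 0 < s
          · simpa only [if_pos h] using ha.st
          · obtain rfl : s = 0 := by omega
            simp only [lt_irrefl, if_false]
            obtain ⟨x, hx, hx2⟩ := ha.st
            refine ⟨x, hx, ?_⟩
            rw [show 0 + (u - 0) = u by omega]
            exact Cl.of_con hcon.symm hx2
        jump := by
          intro t ht
          rcases lt_trichotomy (t + 1) s with h | h | h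
          · simp only [if_pos h, if_pos (show t < s by omega)]
            exact ha.jump t (by omega)
          · simp only [if_pos (show t < s by omega), if_neg (show ¬ t + 1 < s by omega)]
            have := ha.jump t (by omega)
            rw [h] at this ⊢
            rw [show s + (u - s) = u by omega]
            exact this.con_right hcon.symm
          · simp only [if_neg (show ¬ t < s by omega), if_neg (show ¬ t + 1 < s by omega)]
            have := ha.jump (t + (u - s)) (by omega)
            rwa [show t + 1 + (u - s) = t + (u - s) + 1 by omega]
        int := by
          intro t h0 ht
          by_cases h : t < s
          · simp only [if_pos h]
            exact ha.int t h0 (by omega)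
          · simp only [if_neg h]
            exact ha.int _ (by omega) (by omega)
        fin := by
          simp only [if_neg (show ¬ m - (u - s) < s by omega)]
          rw [show m - (u - s) + (u - s) = m by omega]
          exact ha.fin
        zero := by
          intro h
          have h1 : s = 0 := by omega
          subst h1
          simp only [lt_irrefl, if_false]
          rw [show 0 + (u - 0) = u by omega]
          exact hu }
    omega

end CM

namespace CM

lemma tau_lt {m : ℕ} {τ : ℕ → ℕ} (h : ∀ j, j < m → τ j < τ (j + 1)) {a b : ℕ} (hab : a < b)
    (hb : b ≤ m) : τ a < τ b := by
  induction b, hab using Nat.le_induction with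
  | base => exact h a (by omega)
  | succ b hab ih => exact (ih (by omega)).trans (h b (by omega))

lemma tau_le {m : ℕ} {τ : ℕ → ℕ} (h : ∀ j, j < m → τ j < τ (j + 1)) {a b : ℕ} (hab : a ≤ b)
    (hb : b ≤ m) : τ a ≤ τ b := by
  rcases hab.eq_or_lt with rfl | h1
  · exact le_rfl
  · exact (tau_lt h h1 hb).le

theorem greedy (R : ℕ → ℕ → Prop) (N : ℕ) (hR : ∀ s, s < N → R s (s + 1)) :
    ∃ (m : ℕ) (τ : ℕ → ℕ), τ 0 = 0 ∧ τ m = N ∧ (∀ j, j < m → τ j < τ (j + 1)) ∧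
      (∀ j, j < m → R (τ j) (τ (j + 1))) ∧
      ∀ j, j < m → ∀ s, τ (j + 1) < s → s ≤ N → ¬ R (τ j) s := by
  classical
  have key : ∀ k s0, s0 + k = N → ∃ (m : ℕ) (τ : ℕ → ℕ), τ 0 = s0 ∧ τ m = N ∧
      (∀ j, j < m → τ j < τ (j + 1)) ∧ (∀ j, j < m → R (τ j) (τ (j + 1))) ∧
      ∀ j, j < m → ∀ s, τ (j + 1) < s → s ≤ N → ¬ R (τ j) s := by
    intro k
    induction k using Nat.strong_induction_on with
    | _ k ih =>
    intro s0 hk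
    rcases Nat.eq_zero_or_pos k with rfl | hpos
    · exact ⟨0, fun _ => s0, rfl, by omega, by simp, by simp, by simp⟩
    set u := Nat.findGreatest (R s0) N with hu
    have h1 : R s0 u := Nat.findGreatest_spec (P := R s0) (m := s0 + 1) (by omega) (hR s0 (by omega))
    have h2 : s0 + 1 ≤ u := Nat.le_findGreatest (by omega) (hR s0 (by omega))
    have h3 : u ≤ N := Nat.findGreatest_le _
    obtain ⟨m, τ, h4, h5, h6, h7, h8⟩ := ih (N - u) (by omega) u (by omega)
    refine ⟨m + 1, fun j => if j = 0 then s0 else τ (j - 1), by simp, by simpa using h5, ?_, ?_, ?_⟩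
    · rintro (_ | j) hj
      · simp; omega
      · simpa using h6 j (by omega)
    · rintro (_ | j) hj
      · simpa [h4] using h1
      · simpa using h7 j (by omega)
    · rintro (_ | j) hj s hs hsN
      · simp [h4] at hs ⊢
        intro hc
        have := Nat.le_findGreatest hsN hc
        omega
      · simp at hs ⊢
        exact h8 j (by omega) s hs hsN
  exact key N 0 (by omega)

theorem greedy' (R : ℕ → ℕ → Prop) (N : ℕ) (hR : ∀ s, s < N → R s (s + 1)) :
    ∃ (m : ℕ) (τ : ℕ → ℕ), τ 0 = 0 ∧ τ m = N ∧ (∀ j, j < m → τ j < τ (j + 1)) ∧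
      (∀ j, j < m → R (τ j) (τ (j + 1))) ∧
      ∀ j, j < m → ∀ s, s < τ j → ¬ R s (τ (j + 1)) := by
  obtain ⟨m, τ, h1, h2, h3, h4, h5⟩ := greedy (fun s u => R (N - u) (N - s)) N (by
    intro s hs
    have := hR (N - (s + 1)) (by omega)
    rwa [show N - (s + 1) + 1 = N - s by omega] at this)
  have hle : ∀ j, j ≤ m → τ j ≤ N := fun j hj => h2 ▸ tau_le h3 hj le_rfl
  refine ⟨m, fun j => N - τ (m - j), by simp [h2], by simp [h1], ?_, ?_, ?_⟩
  · intro j hj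
    have := h3 (m - (j + 1)) (by omega)
    rw [show m - (j + 1) + 1 = m - j by omega] at this
    have := hle (m - j) (by omega)
    show N - τ (m - j) < N - τ (m - (j + 1))
    omega
  · intro j hj
    have := h4 (m - (j + 1)) (by omega)
    rwa [show m - (j + 1) + 1 = m - j by omega] at this
  · intro j hj s hs hc
    have := h5 (m - (j + 1)) (by omega) (N - s) (by
      rw [show m - (j + 1) + 1 = m - j by omega]
      simp only at hs
      omega) (by omega)
    apply this
    simp only at hs hc ⊢
    rwa [show N - (N - s) = s by omega]

theorem thin {ι : Type} (N C C1 C2 G1 G2 : ℕ) (hC : C1 + G1 ≤ C) (hC1 : C2 + G2 ≤ C1)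
    (i : ℕ → ι) (x y : ℕ → ℕ)
    (hxy : ∀ s, s < N → x s + C ≤ y s) :
    ∃ (m : ℕ) (t : ℕ → ℕ), t 0 = 0 ∧ t m = N ∧ (∀ j, j < m → t j < t (j + 1)) ∧
      (∀ j, j < m → i (t j) = i (t (j + 1) - 1) ∧ x (t (j + 1) - 1) + C2 ≤ y (t j)) ∧
      ∀ j j', j < j' → j' < m → i (t j) = i (t j') →
        y (t j) + G1 ≤ y (t j') ∧ x (t (j + 1) - 1) + G2 ≤ x (t (j' + 1) - 1) ∧
          y (t j) < x (t (j' + 1) - 1) + C2 := by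
  obtain ⟨m, τ, h1, h2, h3, h4, h5⟩ := greedy
    (fun s u => i (u - 1) = i s ∧ x (u - 1) + C1 ≤ y s) N (by
      intro s hs
      have := hxy s hs
      simp
      omega)
  have hτN : ∀ j, j ≤ m → τ j ≤ N := fun j hj => h2 ▸ tau_le h3 hj le_rfl
  have gap : ∀ j j', j < j' → j' < m → i (τ j) = i (τ j') → y (τ j) + G1 ≤ y (τ j') := by
    intro j j' hjj hj' hi
    have h6 := tau_le h3 (show j + 1 ≤ j' by omega) hj'.le
    have h8 := tau_lt h3 hj' le_rfl
    have := h5 j (by omega) (τ j' + 1) (by omega) (by omega)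
    simp only [Nat.add_sub_cancel, not_and, not_le] at this
    have := this hi.symm
    have := hxy (τ j') (by omega)
    omega
  obtain ⟨m2, σ, g1, g2, g3, g4, g5⟩ := greedy'
    (fun j l => i (τ l - 1) = i (τ j) ∧ x (τ l - 1) + C2 ≤ y (τ j)) m (by
      intro j hj
      have := h4 j hj
      exact ⟨this.1, by omega⟩)
  have hσm : ∀ j, j ≤ m2 → σ j ≤ m := fun j hj => g2 ▸ tau_le g3 hj le_rfl
  refine ⟨m2, fun j => τ (σ j), by simp [g1, h1], by simp [g2, h2], ?_, ?_, ?_⟩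
  · intro j hj
    exact tau_lt h3 (g3 j hj) (hσm _ hj)
  · intro j hj
    exact ⟨(g4 j hj).1.symm, (g4 j hj).2⟩
  · intro a a' haa ha' hi
    simp only at hi ⊢
    have k1 : σ (a + 1) ≤ σ a' := tau_le g3 (by omega) (by omega)
    have k2 : σ a < σ (a + 1) := g3 a (by omega)
    have k3 : σ a' < m := by
      have := g3 a' ha'
      have := hσm (a' + 1) ha'
      omega
    have e1 : i (τ (σ (a + 1)) - 1) = i (τ (σ a)) := (g4 a (by omega)).1
    have e2 : i (τ (σ (a' + 1)) - 1) = i (τ (σ a')) := (g4 a' (by omega)).1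
    refine ⟨gap _ _ (by omega) k3 hi, ?_, ?_⟩
    · have := g5 a' ha' (σ (a + 1) - 1) (by omega)
      have k4 := h4 (σ (a + 1) - 1) (by omega)
      rw [show σ (a + 1) - 1 + 1 = σ (a + 1) by omega] at k4
      have := not_and.1 this (by rw [e2, ← hi, ← k4.1, e1])
      omega
    · have := g5 a' ha' (σ a) (by omega)
      have := not_and.1 this (by rw [e2, ← hi])
      omega

end CM

namespace CM
variable {V : Type} {G : SimpleGraph V}

/-- `v` is at distance more than `h` from all rails -/
def High (G : SimpleGraph V) {K : ℕ} (n : Fin K → ℕ) (p : Fin K → ℕ → V) (h : ℕ) (v : V) : Prop :=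
  ∀ i a, a ≤ n i → ¬ Nr G h v (p i a)

/-- `s` is the vertex set of a walk of length at most `ρ` -/
def IsStr (G : SimpleGraph V) (ρ : ℕ) (s : Set V) (o q : V) : Prop :=
  ∃ w : G.Walk o q, w.length ≤ ρ ∧ s = {x | x ∈ w.support}

lemma High.nr {K : ℕ} {n : Fin K → ℕ} {p : Fin K → ℕ → V} {h h' δ : ℕ} {u v : V}
    (hv : High G n p h v) (hn : Nr G δ u v) (hh : h' + δ ≤ h) : High G n p h' u := by
  intro i a ha hc
  exact hv i a ha (hn.symm.tr hc (by omega))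

lemma High.mono {K : ℕ} {n : Fin K → ℕ} {p : Fin K → ℕ → V} {h h' : ℕ} {v : V}
    (hv : High G n p h v) (hh : h' ≤ h) : High G n p h' v :=
  fun i a ha hc => hv i a ha (hc.mono hh)

lemma IsStr.con {ρ : ℕ} {s : Set V} {o q : V} (h : IsStr G ρ s o q) : Con G s o q := by
  obtain ⟨w, hw, rfl⟩ := h
  exact ⟨w, fun x hx => hx⟩

lemma IsStr.split {ρ : ℕ} {s : Set V} {o q z : V} (h : IsStr G ρ s o q) (hz : z ∈ s) :
    ∃ a b, a + b ≤ ρ ∧ Nr G a o z ∧ Nr G b z q := by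
  classical
  obtain ⟨w, hw, rfl⟩ := h
  obtain ⟨w1, w2, h1, -, -⟩ := walk_split w hz
  exact ⟨w1.length, w2.length, by omega, ⟨w1, le_rfl⟩, ⟨w2, le_rfl⟩⟩

lemma IsStr.nr {ρ : ℕ} {s : Set V} {o q z : V} (h : IsStr G ρ s o q) (hz : z ∈ s) :
    Nr G ρ z q := by
  obtain ⟨a, b, h1, h2, h3⟩ := h.split hz
  exact h3.mono (by omega)

lemma IsStr.near {ρ δ : ℕ} {s : Set V} {o q z u : V} (h : IsStr G ρ s o q) (hz : z ∈ s)
    (hu : Nr G δ z u) : Nr G ρ u q ∨ Nr G (2 * δ) o u := by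
  obtain ⟨a, b, h1, h2, h3⟩ := h.split hz
  by_cases ha : δ ≤ a
  · exact Or.inl (hu.symm.tr h3 (by omega))
  · exact Or.inr (h2.tr hu (by omega))

/-- initial portion of a strand up to a high vertex -/
lemma IsStr.portion {K : ℕ} {n : Fin K → ℕ} {p : Fin K → ℕ → V} {ρ h h' : ℕ} {s : Set V} {o z : V}
    {i : Fin K} {y : ℕ} (hy : y ≤ n i) (hs : IsStr G ρ s o (p i y)) (hz : z ∈ s)
    (hh : High G n p h z) (h2 : h' + ρ ≤ 2 * h) :
    ∃ P : Set V, Con G P o z ∧ P ⊆ s ∧ (∀ x ∈ P, High G n p h' x) ∧ ∀ x ∈ P, Nr G ρ x z := by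
  classical
  obtain ⟨w, hw, rfl⟩ := hs
  obtain ⟨w1, w2, h1, hs1, hs2⟩ := walk_split w hz
  have hw2 : h < w2.length := by
    by_contra hc
    exact hh i y hy ⟨w2, by omega⟩
  have hx : ∀ x ∈ w1.support, Nr G w1.length x z := by
    intro x hx
    obtain ⟨v1, v2, h3, -, -⟩ := walk_split w1 hx
    exact ⟨v2, by omega⟩
  exact ⟨{x | x ∈ w1.support}, ⟨w1, fun x hx => hx⟩, hs1, fun x hx' => hh.nr (hx x hx') (by omega),
    fun x hx' => (hx x hx').mono (by omega)⟩

/-- description of a vertex of a connecting set at a step -/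
structure ConnPt (G : SimpleGraph V) (W : Set V) {K : ℕ} (n : Fin K → ℕ) (p : Fin K → ℕ → V)
    (ρ c H1 : ℕ) (A A' : V) (sa sl : Set V) (qa ql : V) (z : V) : Prop where
  high : High G n p c z
  k : z ∈ sa ∨ z ∈ sl ∨ (∃ u, ((Cl G W A u ∧ A ∈ W) ∨ (Cl G W A' u ∧ A' ∈ W)) ∧ Nr G c z u) ∨
    ((∃ z0 ∈ sa, Nr G (3 * c) z z0) ∧ ∃ z0 ∈ sl, Nr G (3 * c) z z0)
  t : (∃ z0 ∈ sa, Nr G c z z0 ∧ High G n p H1 z0) ∨ (∃ z0 ∈ sl, Nr G c z z0 ∧ High G n p H1 z0) ∨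
    (Nr G (2 * ρ + 3 * c) z qa ∧ Nr G (2 * ρ + 3 * c) z ql)

/-- final data from which the new path system is assembled -/
structure D4 (G : SimpleGraph V) (W S T : Set V) {K : ℕ} (n : Fin K → ℕ) (p : Fin K → ℕ → V)
    (ρ c E H1 : ℕ) where
  M : ℕ
  A : ℕ → V
  jp : ℕ → Prop
  I : ℕ → Fin K
  I' : ℕ → Fin K
  Y : ℕ → ℕ
  X : ℕ → ℕ
  o : ℕ → V
  e : ℕ → V
  sa : ℕ → Set V
  sl : ℕ → Set V
  cs : ℕ → Set V
  st : Tch G W S (A 0)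
  fin : Tch G W T (A M)
  zero : M = 0 → A 0 ∈ W
  int : ∀ b, 0 < b → b < M → A b ∈ W
  yn : ∀ b, b < M → Y b ≤ n (I b)
  xn : ∀ b, b < M → X b ≤ n (I' b)
  oA : ∀ b, b < M → Cl G W (A b) (o b)
  eA : ∀ b, b < M → Cl G W (A (b + 1)) (e b)
  sas : ∀ b, b < M → IsStr G ρ (sa b) (o b) (p (I b) (Y b))
  sls : ∀ b, b < M → IsStr G ρ (sl b) (e b) (p (I' b) (X b))
  gy : ∀ b b', b < b' → b' < M → I b = I b' → Y b + E ≤ Y b'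
  gx : ∀ b b', b < b' → b' < M → I' b = I' b' → X b + E ≤ X b'
  gxy : ∀ b b', b < b' → b' < M → I' b = I b' → X b + E ≤ Y b'
  jI : ∀ b, b < M → jp b → I' b = I b
  jxy : ∀ b, b < M → jp b → X b + E ≤ Y b
  g3 : ∀ b0 b b', b0 < b → b < b' → b' < M → jp b0 → jp b → jp b' → I b0 = I b → I b = I b' →
    Y b0 + E ≤ X b'
  f3 : ∀ l b u, l < b → b < M → Cl G W (A l) u → ¬ Nr G ρ u (p (I b) (Y b))
  f4 : ∀ l b u, b + 1 < l → l ≤ M → Cl G W (A l) u → ¬ Nr G ρ u (p (I' b) (X b))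
  f5 : ∀ l l', l < l' → l' ≤ M → A l ∈ W → A l' ∈ W → ¬ Con G W (A l) (A l')
  nA : ∀ b l u z, (b + 2 ≤ l ∨ (l = b + 1 ∧ jp b)) → l ≤ M → A l ∈ W → Cl G W (A l) u → z ∈ sa b →
    ¬ Nr G c z u
  nL : ∀ b b' u z, (b < b' ∨ (b = b' ∧ jp b)) → b' < M → A b ∈ W → Cl G W (A b) u → z ∈ sl b' →
    ¬ Nr G c z u
  nAL : ∀ b b' z z', b < b' → b' < M → z ∈ sa b → z' ∈ sl b' → Nr G (3 * c) z z' →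
    ¬ High G n p H1 z ∧ ¬ High G n p H1 z'
  conn : ∀ b, b < M → ¬ jp b → ∃ v v', Cl G W (A b) v ∧ Cl G W (A (b + 1)) v' ∧ Con G (cs b) v v'
  cpt : ∀ b z, b < M → ¬ jp b → z ∈ cs b → ConnPt G W n p ρ c H1 (A b) (A (b + 1)) (sa b) (sl b)
    (p (I b) (Y b)) (p (I' b) (X b)) z

end CM

namespace CM
variable {V : Type} {G : SimpleGraph V} {W S T : Set V} {K : ℕ} {n : Fin K → ℕ}
  {p : Fin K → ℕ → V} {ρ c E H1 : ℕ}

open Classical in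
/-- the colouring permutation at time `b` -/
noncomputable def D4.pi (Z : D4 G W S T n p ρ c E H1) : ℕ → Equiv.Perm (Option (Fin K))
  | 0 => 1
  | b + 1 => if Z.jp b then Z.pi b * Equiv.swap (some (Z.I b)) none else Z.pi b

open Classical in
/-- current position on rail `i` at time `b` -/
noncomputable def D4.cur (Z : D4 G W S T n p ρ c E H1) : ℕ → Fin K → ℕ
  | 0, _ => 0
  | b + 1, i => if Z.jp b ∧ Z.I b = i then Z.Y b else Z.cur b i

open Classical in
/-- the position on rail `i` reached in phase `b` -/
noncomputable def D4.endp (Z : D4 G W S T n p ρ c E H1) (b : ℕ) (i : Fin K) : ℕ :=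
  if b < Z.M then (if Z.jp b ∧ Z.I b = i then Z.X b else Z.cur b i) else n i

/-- coloured vertices of the new path system -/
inductive D4.Atom (Z : D4 G W S T n p ρ c E H1) : V → Option (Fin K) → Prop
  | K (b : ℕ) (v : V) (hb : b ≤ Z.M) (hW : Z.A b ∈ W) (hv : Cl G W (Z.A b) v) :
      D4.Atom Z v (Z.pi b none)
  | cs (b : ℕ) (v : V) (hb : b < Z.M) (hj : ¬ Z.jp b) (hv : v ∈ Z.cs b) : D4.Atom Z v (Z.pi b none)
  | sa (b : ℕ) (v : V) (hb : b < Z.M) (hj : Z.jp b) (hv : v ∈ Z.sa b) : D4.Atom Z v (Z.pi b none)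
  | sl (b : ℕ) (v : V) (hb : b < Z.M) (hj : Z.jp b) (hv : v ∈ Z.sl b) :
      D4.Atom Z v (Z.pi b (some (Z.I b)))
  | P (b : ℕ) (i : Fin K) (a : ℕ) (hb : b ≤ Z.M) (h1 : min (Z.cur b i) (Z.endp b i) ≤ a)
      (h2 : a ≤ max (Z.cur b i) (Z.endp b i)) : D4.Atom Z (p i a) (Z.pi b (some i))

variable (Z : D4 G W S T n p ρ c E H1)

lemma D4.pi_conn {b : ℕ} (h : ¬ Z.jp b) : Z.pi (b + 1) = Z.pi b := by
  simp [D4.pi, h]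
lemma D4.pi_jump_none {b : ℕ} (h : Z.jp b) : Z.pi (b + 1) none = Z.pi b (some (Z.I b)) := by
  simp [D4.pi, h]
lemma D4.pi_jump_some {b : ℕ} (h : Z.jp b) : Z.pi (b + 1) (some (Z.I b)) = Z.pi b none := by
  simp [D4.pi, h]
lemma D4.pi_other {b : ℕ} {i : Fin K} (h : ¬ (Z.jp b ∧ Z.I b = i)) :
    Z.pi (b + 1) (some i) = Z.pi b (some i) := by
  by_cases hj : Z.jp b
  · have : Z.I b ≠ i := fun hi => h ⟨hj, hi⟩
    simp only [D4.pi, hj, if_true, Equiv.Perm.mul_apply]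
    rw [Equiv.swap_apply_of_ne_of_ne]
    · simpa using this.symm
    · simp
  · rw [Z.pi_conn hj]
lemma D4.cur_jump {b : ℕ} (h : Z.jp b) : Z.cur (b + 1) (Z.I b) = Z.Y b := by
  simp [D4.cur, h]
lemma D4.cur_other {b : ℕ} {i : Fin K} (h : ¬ (Z.jp b ∧ Z.I b = i)) :
    Z.cur (b + 1) i = Z.cur b i := by
  simp [D4.cur, h]

lemma D4.cur_le {b : ℕ} (hb : b ≤ Z.M) (i : Fin K) : Z.cur b i ≤ n i := by
  induction b with
  | zero => simp [D4.cur]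
  | succ b ih =>
    by_cases h : Z.jp b ∧ Z.I b = i
    · obtain ⟨h, rfl⟩ := h
      rw [Z.cur_jump h]
      exact Z.yn b (by omega)
    · rw [Z.cur_other h]
      exact ih (by omega)

lemma D4.endp_le {b : ℕ} (hb : b ≤ Z.M) (i : Fin K) : Z.endp b i ≤ n i := by
  unfold D4.endp
  split_ifs with h1 h2
  · rw [← h2.2, ← Z.jI b h1 h2.1]
    exact Z.xn b h1
  · exact Z.cur_le hb i
  · exact le_rfl

lemma D4.cur_cases (b : ℕ) (i : Fin K) : Z.cur b i = 0 ∨ ∃ b0 < b, Z.jp b0 ∧ Z.I b0 = i ∧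
    Z.cur b i = Z.Y b0 := by
  induction b with
  | zero => exact Or.inl rfl
  | succ b ih =>
    by_cases h : Z.jp b ∧ Z.I b = i
    · obtain ⟨h, rfl⟩ := h
      exact Or.inr ⟨b, by omega, h, rfl, Z.cur_jump h⟩
    · rw [Z.cur_other h]
      rcases ih with ih | ⟨b0, h1, h2⟩
      · exact Or.inl ih
      · exact Or.inr ⟨b0, by omega, h2⟩

lemma D4.cur_ge {b0 b : ℕ} (h0 : b0 < b) (hb : b ≤ Z.M) (hj : Z.jp b0) :
    Z.Y b0 ≤ Z.cur b (Z.I b0) := by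
  induction b, h0 using Nat.le_induction with
  | base => exact (Z.cur_jump hj).ge
  | succ b h ih =>
    by_cases h' : Z.jp b ∧ Z.I b = Z.I b0
    · rw [← h'.2, Z.cur_jump h'.1]
      have := Z.gy b0 b h (by omega) h'.2.symm
      omega
    · rw [Z.cur_other h']
      exact ih (by omega)

lemma D4.pi_eq_or {b b' : ℕ} (hb : b ≤ b') (i : Fin K) : Z.pi b (some i) = Z.pi b' (some i) ∨
    ∃ b1, b ≤ b1 ∧ b1 < b' ∧ Z.jp b1 ∧ Z.I b1 = i := by
  induction b', hb using Nat.le_induction with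
  | base => exact Or.inl rfl
  | succ b' h ih =>
    rcases ih with ih | ⟨b1, h1, h2, h3⟩
    · by_cases h' : Z.jp b' ∧ Z.I b' = i
      · exact Or.inr ⟨b', h, by omega, h'⟩
      · left
        rw [Z.pi_other h', ih]
    · exact Or.inr ⟨b1, h1, by omega, h3⟩

lemma D4.interval {b b' : ℕ} (hb : b < b') (hb' : b' ≤ Z.M) (i : Fin K) (a a' : ℕ)
    (ha : a ≤ max (Z.cur b i) (Z.endp b i)) (ha' : min (Z.cur b' i) (Z.endp b' i) ≤ a') :
    Z.pi b (some i) = Z.pi b' (some i) ∨ a + E ≤ a' := by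
  rcases Z.pi_eq_or hb.le i with h | ⟨b1, hb1, hb1', hj1, hi1⟩
  · exact Or.inl h
  right
  -- upper end of the first interval
  have hup : a = 0 ∨ (∃ b0 < b, Z.jp b0 ∧ Z.I b0 = i ∧ a ≤ Z.Y b0) ∨
      (Z.jp b ∧ Z.I b = i ∧ a ≤ Z.X b) := by
    have hbM : b < Z.M := by omega
    have hcur : a ≤ Z.cur b i → a = 0 ∨ ∃ b0 < b, Z.jp b0 ∧ Z.I b0 = i ∧ a ≤ Z.Y b0 := by
      intro hle
      rcases Z.cur_cases b i with h | ⟨b0, h1, h2, h3, h4⟩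
      · left; omega
      · exact Or.inr ⟨b0, h1, h2, h3, h4 ▸ hle⟩
    rcases le_max_iff.1 ha with h | h
    · rcases hcur h with h | h
      · exact Or.inl h
      · exact Or.inr (Or.inl h)
    · unfold D4.endp at h
      rw [if_pos hbM] at h
      split_ifs at h with h1
      · exact Or.inr (Or.inr ⟨h1.1, h1.2, h⟩)
      · rcases hcur h with h | h
        · exact Or.inl h
        · exact Or.inr (Or.inl h)
  -- lower end of the second interval
  have hlow : Z.cur b' i ≤ a' ∨ (b' < Z.M ∧ Z.jp b' ∧ Z.I b' = i ∧ Z.X b' ≤ a') := by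
    rcases min_le_iff.1 ha' with h | h
    · exact Or.inl h
    · unfold D4.endp at h
      split_ifs at h with h1 h2
      · exact Or.inr ⟨h1, h2.1, h2.2, h⟩
      · exact Or.inl h
      · exact Or.inl ((Z.cur_le hb' i).trans h)
  have e1 := Z.jxy b1 (by omega) hj1
  rcases hlow with hl | ⟨hM, hj, hi, hl⟩
  · have c1 := Z.cur_ge hb1' hb' hj1
    rw [hi1] at c1
    rcases hup with hu | ⟨b0, h1, h2, h3, h4⟩ | ⟨h1, h2, h3⟩
    · omega
    · have := Z.gy b0 b1 (by omega) (by omega) (by rw [h3, hi1])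
      omega
    · have := Z.jxy b (by omega) h1
      have c2 := Z.cur_ge hb hb' h1
      rw [h2] at c2
      omega
  · have hI : ∀ b, b < Z.M → Z.jp b → Z.I b = i → Z.I' b = i := fun b h1 h2 h3 => by
      rw [Z.jI b h1 h2, h3]
    have e2 := Z.gx b1 b' hb1' hM (by rw [hI b1 (by omega) hj1 hi1, hI b' hM hj hi])
    rcases hup with hu | ⟨b0, h1, h2, h3, h4⟩ | ⟨h1, h2, h3⟩
    · omega
    · have := Z.g3 b0 b1 b' (by omega) hb1' hM h2 hj1 hj (by rw [h3, hi1]) (by rw [hi1, hi])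
      omega
    · have := Z.gx b b' hb hM (by rw [hI b (by omega) h1 h2, hI b' hM hj hi])
      omega

/-- a vertex close to a coloured rail piece -/
def D4.RailPt (v : V) (κ : Option (Fin K)) : Prop :=
  ∃ b i a, b ≤ Z.M ∧ min (Z.cur b i) (Z.endp b i) ≤ a ∧ a ≤ max (Z.cur b i) (Z.endp b i) ∧
    Nr G ρ v (p i a) ∧ κ = Z.pi b (some i)

lemma D4.rail_sa {b : ℕ} {v : V} (hb : b < Z.M) (hj : Z.jp b) (hv : v ∈ Z.sa b) :
    Z.RailPt v (Z.pi b none) := by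
  refine ⟨b + 1, Z.I b, Z.Y b, hb, ?_, ?_, (Z.sas b hb).nr hv, (Z.pi_jump_some hj).symm⟩
  · rw [Z.cur_jump hj]; exact min_le_left _ _
  · rw [Z.cur_jump hj]; exact le_max_left _ _

lemma D4.rail_sl {b : ℕ} {v : V} (hb : b < Z.M) (hj : Z.jp b) (hv : v ∈ Z.sl b) :
    Z.RailPt v (Z.pi b (some (Z.I b))) := by
  have he : Z.endp b (Z.I b) = Z.X b := by simp [D4.endp, hb, hj]
  refine ⟨b, Z.I b, Z.X b, hb.le, ?_, ?_, ?_, rfl⟩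
  · rw [he]; exact min_le_right _ _
  · rw [he]; exact le_max_right _ _
  · have := (Z.sls b hb).nr hv
    rwa [Z.jI b hb hj] at this

lemma D4.rail_rail {Lr D : ℕ} (hR : Rails G S T K Lr D n p) (hL : 4 * ρ + 8 * c ≤ Lr) (hE : D < E)
    {v v' : V} {κ κ' : Option (Fin K)} (h : Z.RailPt v κ) (h' : Z.RailPt v' κ') (hn : Nr G c v v') :
    κ = κ' := by
  obtain ⟨b, i, a, h1, h2, h3, h4, rfl⟩ := h
  obtain ⟨b', i', a', h1', h2', h3', h4', rfl⟩ := h'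
  have ha : a ≤ n i := h3.trans (max_le (Z.cur_le h1 i) (Z.endp_le h1 i))
  have ha' : a' ≤ n i' := h3'.trans (max_le (Z.cur_le h1' i') (Z.endp_le h1' i'))
  obtain ⟨rfl, e1, e2⟩ := hR.rp i i' a a' ha ha' ((h4.symm.trans hn).tr h4' (by omega))
  rcases lt_trichotomy b b' with hlt | rfl | hlt
  · exact (Z.interval hlt h1' i a a' h3 h2').resolve_right (by omega)
  · rfl
  · exact ((Z.interval hlt h1 i a' a h3' h2).resolve_right (by omega)).symm

lemma D4.KA_lt (hconn : ∀ u ∈ W, ∀ u' ∈ W, Nr G (8 * c) u u' → Con G W u u') {l b δ : ℕ} {u z : V}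
    (hδ : δ ≤ 4 * c) (hl : l < b) (hb : b < Z.M) (hW : Z.A l ∈ W) (hu : Cl G W (Z.A l) u)
    (hz : z ∈ Z.sa b) (hn : Nr G δ z u) : False := by
  rcases (Z.sas b hb).near hz hn with h | h
  · exact Z.f3 l b u hl hb hu h
  · have hbW := Z.int b (by omega) hb
    have h1 := (Z.oA b hb).con hbW
    have h2 := hu.con hW
    exact Z.f5 l b hl hb.le hW hbW
      ((h2.trans (hconn _ h1.right _ h2.right (h.mono (by omega))).symm).trans h1.symm)

lemma D4.KL_gt (hconn : ∀ u ∈ W, ∀ u' ∈ W, Nr G (8 * c) u u' → Con G W u u') {l b δ : ℕ} {u z : V}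
    (hδ : δ ≤ 4 * c) (hl : b + 1 < l) (hb : l ≤ Z.M) (hW : Z.A l ∈ W) (hu : Cl G W (Z.A l) u)
    (hz : z ∈ Z.sl b) (hn : Nr G δ z u) : False := by
  rcases (Z.sls b (by omega)).near hz hn with h | h
  · exact Z.f4 l b u hl hb hu h
  · have hbW := Z.int (b + 1) (by omega) (by omega)
    have h1 := (Z.eA b (by omega)).con hbW
    have h2 := hu.con hW
    exact Z.f5 (b + 1) l hl hb hbW hW
      ((h1.trans (hconn _ h1.right _ h2.right (h.mono (by omega)))).trans h2.symm)

lemma D4.KK (hconn : ∀ u ∈ W, ∀ u' ∈ W, Nr G (8 * c) u u' → Con G W u u') {l b δ : ℕ} {u z : V}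
    (hδ : δ ≤ 4 * c) (hl : l ≤ Z.M) (hb : b ≤ Z.M) (hne : l ≠ b) (hW : Z.A l ∈ W)
    (hu : Cl G W (Z.A l) u) (hW' : Z.A b ∈ W) (hz : Cl G W (Z.A b) z) (hn : Nr G δ z u) : False := by
  have h1 := hu.con hW
  have h2 := hz.con hW'
  have h3 := (h1.trans (hconn _ h2.right _ h1.right (hn.mono (by omega))).symm).trans h2.symm
  rcases lt_or_gt_of_ne hne with h | h
  · exact Z.f5 l b h hb hW hW' h3
  · exact Z.f5 b l h hl hW' hW h3.symm

lemma D4.Kcs (hconn : ∀ u ∈ W, ∀ u' ∈ W, Nr G (8 * c) u u' → Con G W u u') {l b : ℕ} {u z : V}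
    (hl : l ≤ Z.M) (hb : b < Z.M) (hW : Z.A l ∈ W) (hu : Cl G W (Z.A l) u)
    (hj : ¬ Z.jp b) (hz : z ∈ Z.cs b) (hn : Nr G c z u) : Z.pi l none = Z.pi b none := by
  rcases eq_or_ne l b with rfl | hne
  · rfl
  rcases eq_or_ne l (b + 1) with rfl | hne1
  · rw [Z.pi_conn hj]
  exfalso
  have hpt := Z.cpt b z hb hj hz
  rcases hpt.k with h | h | ⟨u', h1 | h1, h2⟩ | ⟨⟨z0, h1, h2⟩, ⟨z1, h3, h4⟩⟩
  · rcases lt_or_ge l b with hlt | hge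
    · exact Z.KA_lt hconn (by omega) hlt hb hW hu h hn
    · exact Z.nA b l u z (by omega) hl hW hu h hn
  · rcases lt_or_ge l b with hlt | hge
    · exact Z.nL l b u z (by omega) hb hW hu h hn
    · exact Z.KL_gt hconn (δ := c) (by omega) (by omega) hl hW hu h hn
  · exact Z.KK hconn (δ := c + c) (by omega) hl hb.le hne hW hu h1.2 h1.1 (h2.symm.trans hn)
  · exact Z.KK hconn (δ := c + c) (by omega) hl hb hne1 hW hu h1.2 h1.1 (h2.symm.trans hn)
  · rcases lt_or_ge l b with hlt | hge
    · exact Z.KA_lt hconn (δ := 4 * c) le_rfl hlt hb hW hu h1 (h2.symm.tr hn (by omega))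
    · exact Z.KL_gt hconn (δ := 4 * c) le_rfl (by omega) hl hW hu h3 (h4.symm.tr hn (by omega))

lemma D4.Ksa (hconn : ∀ u ∈ W, ∀ u' ∈ W, Nr G (8 * c) u u' → Con G W u u') {l b : ℕ} {u z : V}
    (hl : l ≤ Z.M) (hb : b < Z.M) (hW : Z.A l ∈ W) (hu : Cl G W (Z.A l) u)
    (hj : Z.jp b) (hz : z ∈ Z.sa b) (hn : Nr G c z u) : Z.pi l none = Z.pi b none := by
  rcases lt_trichotomy l b with hlt | rfl | hgt
  · exact (Z.KA_lt hconn (by omega) hlt hb hW hu hz hn).elim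
  · rfl
  · refine (Z.nA b l u z ?_ hl hW hu hz hn).elim
    rcases eq_or_ne l (b + 1) with h | h
    · exact Or.inr ⟨h, hj⟩
    · left; omega

lemma D4.Ksl (hconn : ∀ u ∈ W, ∀ u' ∈ W, Nr G (8 * c) u u' → Con G W u u') {l b : ℕ} {u z : V}
    (hl : l ≤ Z.M) (hb : b < Z.M) (hW : Z.A l ∈ W) (hu : Cl G W (Z.A l) u)
    (hj : Z.jp b) (hz : z ∈ Z.sl b) (hn : Nr G c z u) : Z.pi l none = Z.pi b (some (Z.I b)) := by
  rcases lt_trichotomy l (b + 1) with hlt | rfl | hgt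
  · refine (Z.nL l b u z ?_ hb hW hu hz hn).elim
    rcases eq_or_ne l b with h | h
    · exact Or.inr ⟨h, h ▸ hj⟩
    · left; omega
  · exact Z.pi_jump_none hj
  · exact (Z.KL_gt hconn (δ := c) (by omega) hgt hl hW hu hz hn).elim

/-- tag of a vertex at step `b` -/
def D4.Tag (f : Prop) (b : ℕ) (z : V) : Prop :=
  (∃ z0 ∈ Z.sa b, Nr G c z z0 ∧ (f → High G n p H1 z0)) ∨
  (∃ z0 ∈ Z.sl b, Nr G c z z0 ∧ (f → High G n p H1 z0)) ∨
  (Nr G (2 * ρ + 3 * c) z (p (Z.I b) (Z.Y b)) ∧ Nr G (2 * ρ + 3 * c) z (p (Z.I' b) (Z.X b)))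

lemma D4.tag_tag {Lr D : ℕ} (hR : Rails G S T K Lr D n p) (hL : 4 * ρ + 8 * c ≤ Lr) (hE : D < E)
    {f f' : Prop} (hf : f ∨ f') {b b' : ℕ} (hb : b < b') (hb' : b' < Z.M) {z z' : V}
    (h : Z.Tag f b z) (h' : Z.Tag f' b' z') (hn : Nr G c z z') : False := by
  have yy : Nr G (2 * ρ + 3 * c) z (p (Z.I b) (Z.Y b)) →
      Nr G (2 * ρ + 3 * c) z' (p (Z.I b') (Z.Y b')) → False := by
    intro h1 h2
    obtain ⟨e1, e2, e3⟩ := hR.rp _ _ _ _ (Z.yn b (by omega)) (Z.yn b' hb')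
      ((h1.symm.trans hn).tr h2 (by omega))
    have := Z.gy b b' hb hb' e1
    omega
  have xx : Nr G (2 * ρ + 3 * c) z (p (Z.I' b) (Z.X b)) →
      Nr G (2 * ρ + 3 * c) z' (p (Z.I' b') (Z.X b')) → False := by
    intro h1 h2
    obtain ⟨e1, e2, e3⟩ := hR.rp _ _ _ _ (Z.xn b (by omega)) (Z.xn b' hb')
      ((h1.symm.trans hn).tr h2 (by omega))
    have := Z.gx b b' hb hb' e1
    omega
  have xy : Nr G (2 * ρ + 3 * c) z (p (Z.I' b) (Z.X b)) →
      Nr G (2 * ρ + 3 * c) z' (p (Z.I b') (Z.Y b')) → False := by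
    intro h1 h2
    obtain ⟨e1, e2, e3⟩ := hR.rp _ _ _ _ (Z.xn b (by omega)) (Z.yn b' hb')
      ((h1.symm.trans hn).tr h2 (by omega))
    have := Z.gxy b b' hb hb' e1
    omega
  have ta : ∀ b, b < Z.M → ∀ z z0, z0 ∈ Z.sa b → Nr G c z z0 →
      Nr G (2 * ρ + 3 * c) z (p (Z.I b) (Z.Y b)) := fun b hb z z0 h1 h2 =>
    h2.tr ((Z.sas b hb).nr h1) (by omega)
  have tl : ∀ b, b < Z.M → ∀ z z0, z0 ∈ Z.sl b → Nr G c z z0 →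
      Nr G (2 * ρ + 3 * c) z (p (Z.I' b) (Z.X b)) := fun b hb z z0 h1 h2 =>
    h2.tr ((Z.sls b hb).nr h1) (by omega)
  rcases h with ⟨z0, h1, h2, h3⟩ | ⟨z0, h1, h2, h3⟩ | ⟨h1, h2⟩
  · have q1 := ta b (by omega) z z0 h1 h2
    rcases h' with ⟨z1, h4, h5, h6⟩ | ⟨z1, h4, h5, h6⟩ | ⟨h4, h5⟩
    · exact yy q1 (ta b' hb' z' z1 h4 h5)
    · have := Z.nAL b b' z0 z1 hb hb' h1 h4 ((h2.symm.trans hn).tr h5 (by omega))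
      rcases hf with hf | hf
      · exact this.1 (h3 hf)
      · exact this.2 (h6 hf)
    · exact yy q1 h4
  · have q1 := tl b (by omega) z z0 h1 h2
    rcases h' with ⟨z1, h4, h5, h6⟩ | ⟨z1, h4, h5, h6⟩ | ⟨h4, h5⟩
    · exact xy q1 (ta b' hb' z' z1 h4 h5)
    · exact xx q1 (tl b' hb' z' z1 h4 h5)
    · exact xx q1 h5
  · rcases h' with ⟨z1, h4, h5, h6⟩ | ⟨z1, h4, h5, h6⟩ | ⟨h4, h5⟩
    · exact yy h1 (ta b' hb' z' z1 h4 h5)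
    · exact xx h2 (tl b' hb' z' z1 h4 h5)
    · exact yy h1 h4

lemma D4.tag_cs {b : ℕ} {z : V} (hb : b < Z.M) (hj : ¬ Z.jp b) (hz : z ∈ Z.cs b) :
    Z.Tag True b z := by
  rcases (Z.cpt b z hb hj hz).t with ⟨z0, h1, h2, h3⟩ | ⟨z0, h1, h2, h3⟩ | h
  · exact Or.inl ⟨z0, h1, h2, fun _ => h3⟩
  · exact Or.inr (Or.inl ⟨z0, h1, h2, fun _ => h3⟩)
  · exact Or.inr (Or.inr h)

lemma D4.tag_sa {b : ℕ} {z : V} (hz : z ∈ Z.sa b) : Z.Tag False b z :=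
  Or.inl ⟨z, hz, Nr.refl _ _, False.elim⟩
lemma D4.tag_sl {b : ℕ} {z : V} (hz : z ∈ Z.sl b) : Z.Tag False b z :=
  Or.inr (Or.inl ⟨z, hz, Nr.refl _ _, False.elim⟩)

theorem D4.sep {Lr D : ℕ} (hR : Rails G S T K Lr D n p) (hL : 4 * ρ + 8 * c ≤ Lr) (hE : D < E)
    (hconn : ∀ u ∈ W, ∀ u' ∈ W, Nr G (8 * c) u u' → Con G W u u')
    (hhigh : ∀ w ∈ W, High G n p c w)
    {v v' : V} {κ κ' : Option (Fin K)} (h : Z.Atom v κ) (h' : Z.Atom v' κ') (hn : Nr G c v v') :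
    κ = κ' := by
  have itv : ∀ b i a, b ≤ Z.M → a ≤ max (Z.cur b i) (Z.endp b i) → a ≤ n i := fun b i a hb h =>
    h.trans (max_le (Z.cur_le hb i) (Z.endp_le hb i))
  have tt : ∀ {f f' : Prop} (_ : f ∨ f') {b b' : ℕ} (_ : b ≠ b') (_ : b < Z.M) (_ : b' < Z.M)
      {z z' : V} (_ : Z.Tag f b z) (_ : Z.Tag f' b' z') (_ : Nr G c z z'), False := by
    intro f f' hf b b' hne hb hb' z z' h1 h2 h3
    rcases lt_or_gt_of_ne hne with h | h
    · exact Z.tag_tag hR hL hE hf h hb' h1 h2 h3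
    · exact Z.tag_tag hR hL hE hf.symm h hb h2 h1 h3.symm
  cases h with
  | K b v hb hW hv =>
    cases h' with
    | K b' v' hb' hW' hv' =>
      by_cases hbb : b = b'
      · rw [hbb]
      · exact (Z.KK hconn (δ := c) (by omega) hb' hb (Ne.symm hbb) hW' hv' hW hv hn).elim
    | cs b' v' hb' hj' hv' => exact Z.Kcs hconn hb hb' hW hv hj' hv' hn.symm
    | sa b' v' hb' hj' hv' => exact Z.Ksa hconn hb hb' hW hv hj' hv' hn.symm
    | sl b' v' hb' hj' hv' => exact Z.Ksl hconn hb hb' hW hv hj' hv' hn.symm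
    | P b' i' a' hb' h1' h2' =>
      exact (hhigh v (hv.con hW).right i' a' (itv b' i' a' hb' h2') hn).elim
  | cs b v hb hj hv =>
    cases h' with
    | K b' v' hb' hW' hv' => exact (Z.Kcs hconn hb' hb hW' hv' hj hv hn).symm
    | cs b' v' hb' hj' hv' =>
      by_cases hbb : b = b'
      · rw [hbb]
      · exact (tt (Or.inl trivial) hbb hb hb' (Z.tag_cs hb hj hv) (Z.tag_cs hb' hj' hv') hn).elim
    | sa b' v' hb' hj' hv' =>
      refine (tt (Or.inl trivial) ?_ hb hb' (Z.tag_cs hb hj hv) (Z.tag_sa hv') hn).elim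
      rintro rfl; exact hj hj'
    | sl b' v' hb' hj' hv' =>
      refine (tt (Or.inl trivial) ?_ hb hb' (Z.tag_cs hb hj hv) (Z.tag_sl hv') hn).elim
      rintro rfl; exact hj hj'
    | P b' i' a' hb' h1' h2' =>
      exact ((Z.cpt b v hb hj hv).high i' a' (itv b' i' a' hb' h2') hn).elim
  | sa b v hb hj hv =>
    have hr := Z.rail_sa hb hj hv
    cases h' with
    | K b' v' hb' hW' hv' => exact (Z.Ksa hconn hb' hb hW' hv' hj hv hn).symm
    | cs b' v' hb' hj' hv' =>
      refine (tt (Or.inr trivial) ?_ hb hb' (Z.tag_sa hv) (Z.tag_cs hb' hj' hv') hn).elim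
      rintro rfl; exact hj' hj
    | sa b' v' hb' hj' hv' => exact Z.rail_rail hR hL hE hr (Z.rail_sa hb' hj' hv') hn
    | sl b' v' hb' hj' hv' => exact Z.rail_rail hR hL hE hr (Z.rail_sl hb' hj' hv') hn
    | P b' i' a' hb' h1' h2' =>
      exact Z.rail_rail hR hL hE hr ⟨b', i', a', hb', h1', h2', Nr.refl _ _, rfl⟩ hn
  | sl b v hb hj hv =>
    have hr := Z.rail_sl hb hj hv
    cases h' with
    | K b' v' hb' hW' hv' => exact (Z.Ksl hconn hb' hb hW' hv' hj hv hn).symm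
    | cs b' v' hb' hj' hv' =>
      refine (tt (Or.inr trivial) ?_ hb hb' (Z.tag_sl hv) (Z.tag_cs hb' hj' hv') hn).elim
      rintro rfl; exact hj' hj
    | sa b' v' hb' hj' hv' => exact Z.rail_rail hR hL hE hr (Z.rail_sa hb' hj' hv') hn
    | sl b' v' hb' hj' hv' => exact Z.rail_rail hR hL hE hr (Z.rail_sl hb' hj' hv') hn
    | P b' i' a' hb' h1' h2' =>
      exact Z.rail_rail hR hL hE hr ⟨b', i', a', hb', h1', h2', Nr.refl _ _, rfl⟩ hn
  | P b i a hb h1 h2 =>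
    have hr : Z.RailPt (p i a) (Z.pi b (some i)) := ⟨b, i, a, hb, h1, h2, Nr.refl _ _, rfl⟩
    cases h' with
    | K b' v' hb' hW' hv' =>
      exact (hhigh v' (hv'.con hW').right i a (itv b i a hb h2) hn.symm).elim
    | cs b' v' hb' hj' hv' =>
      exact ((Z.cpt b' v' hb' hj' hv').high i a (itv b i a hb h2) hn.symm).elim
    | sa b' v' hb' hj' hv' => exact Z.rail_rail hR hL hE hr (Z.rail_sa hb' hj' hv') hn
    | sl b' v' hb' hj' hv' => exact Z.rail_rail hR hL hE hr (Z.rail_sl hb' hj' hv') hn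
    | P b' i' a' hb' h1' h2' =>
      exact Z.rail_rail hR hL hE hr ⟨b', i', a', hb', h1', h2', Nr.refl _ _, rfl⟩ hn

end CM

namespace CM
variable {V : Type} {G : SimpleGraph V} {W S T : Set V} {K : ℕ} {n : Fin K → ℕ}
  {p : Fin K → ℕ → V} {ρ c E H1 : ℕ}

lemma rail_con_le {Lr D : ℕ} (hR : Rails G S T K Lr D n p) (i : Fin K) (a b : ℕ) (hab : a ≤ b)
    (hb : b ≤ n i) : Con G {x | ∃ t, a ≤ t ∧ t ≤ b ∧ x = p i t} (p i a) (p i b) := by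
  induction b, hab using Nat.le_induction with
  | base => exact Con.refl ⟨a, le_rfl, le_rfl, rfl⟩
  | succ b h ih =>
    refine ((ih (by omega)).mono ?_).trans ?_
    · rintro x ⟨t, h1, h2, h3⟩
      exact ⟨t, h1, by omega, h3⟩
    · refine ⟨(hR.adj i b (by omega)).toWalk, ?_⟩
      intro x hx
      simp at hx
      rcases hx with rfl | rfl
      · exact ⟨b, h, by omega, rfl⟩
      · exact ⟨b + 1, by omega, by omega, rfl⟩

lemma rail_con {Lr D : ℕ} (hR : Rails G S T K Lr D n p) (i : Fin K) (a b : ℕ) (ha : a ≤ n i)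
    (hb : b ≤ n i) : Con G {x | ∃ t, min a b ≤ t ∧ t ≤ max a b ∧ x = p i t} (p i a) (p i b) := by
  rcases le_total a b with h | h
  · rw [min_eq_left h, max_eq_right h]
    exact rail_con_le hR i a b h hb
  · rw [min_eq_right h, max_eq_left h]
    exact (rail_con_le hR i b a h ha).symm

variable (Z : D4 G W S T n p ρ c E H1)

lemma D4.node_mem {b : ℕ} (hb : b ≤ Z.M) : Z.Atom (Z.A b) (Z.pi b none) := by
  by_cases hW : Z.A b ∈ W
  · exact D4.Atom.K b _ hb hW (Cl.refl _ _)
  have hM : Z.M ≠ 0 := by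
    intro h
    have h0 : b = 0 := by omega
    subst h0
    exact hW (Z.zero h)
  rcases Nat.eq_zero_or_pos b with rfl | hpos
  · by_cases hj : Z.jp 0
    · have h1 := (Z.oA 0 (by omega)).eq_of_not hW
      have h2 := (Z.sas 0 (by omega)).con.left
      rw [h1] at h2
      exact D4.Atom.sa 0 _ (by omega) hj h2
    · obtain ⟨v, v', h1, h2, h3⟩ := Z.conn 0 (by omega) hj
      have h4 := h3.left
      rw [h1.eq_of_not hW] at h4
      exact D4.Atom.cs 0 _ (by omega) hj h4
  · rcases hb.lt_or_eq with hlt | heq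
    · exact (hW (Z.int b hpos hlt)).elim
    obtain ⟨b', rfl⟩ : ∃ b', b = b' + 1 := ⟨b - 1, by omega⟩
    by_cases hj : Z.jp b'
    · have h1 := (Z.eA b' (by omega)).eq_of_not hW
      have h2 := (Z.sls b' (by omega)).con.left
      rw [h1] at h2
      rw [Z.pi_jump_none hj]
      exact D4.Atom.sl b' _ (by omega) hj h2
    · obtain ⟨v, v', h1, h2, h3⟩ := Z.conn b' (by omega) hj
      have h4 := h3.right
      rw [h2.eq_of_not hW] at h4
      rw [Z.pi_conn hj]
      exact D4.Atom.cs b' _ (by omega) hj h4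

lemma D4.node {b : ℕ} (hb : b ≤ Z.M) {v : V} (hv : Cl G W (Z.A b) v) :
    Con G {x | Z.Atom x (Z.pi b none)} (Z.A b) v := by
  classical
  by_cases hW : Z.A b ∈ W
  · obtain ⟨w, hw⟩ := hv.con hW
    refine ⟨w, fun x hx => D4.Atom.K b x hb hW (Or.inr ?_)⟩
    obtain ⟨w1, w2, -, h1, -⟩ := walk_split w hx
    exact ⟨w1, fun y hy => hw y (h1 y hy)⟩
  · rw [hv.eq_of_not hW]
    exact Con.refl (Z.node_mem hb)

lemma D4.fwd {Lr D : ℕ} (hR : Rails G S T K Lr D n p) (b : ℕ) (hb : b ≤ Z.M) :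
    (∃ s ∈ S, Con G {x | Z.Atom x (Z.pi b none)} s (Z.A b)) ∧
    ∀ i, ∃ s ∈ S, Con G {x | Z.Atom x (Z.pi b (some i))} s (p i (Z.cur b i)) := by
  induction b with
  | zero =>
    constructor
    · obtain ⟨s, hs, h⟩ := Z.st
      exact ⟨s, hs, (Z.node hb h).symm⟩
    · intro i
      refine ⟨p i 0, hR.start i, Con.refl ?_⟩
      have : Z.cur 0 i = 0 := rfl
      exact D4.Atom.P 0 i 0 hb (by simp [this]) (by simp)
  | succ b ih =>
    obtain ⟨ih1, ih2⟩ := ih (by omega)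
    by_cases hj : Z.jp b
    · constructor
      · obtain ⟨s, hs, h⟩ := ih2 (Z.I b)
        refine ⟨s, hs, ?_⟩
        have he : Z.endp b (Z.I b) = Z.X b := by simp [D4.endp, hj]; omega
        have h1 := rail_con hR (Z.I b) (Z.cur b (Z.I b)) (Z.endp b (Z.I b)) (Z.cur_le (by omega) _)
          (Z.endp_le (by omega) _)
        have h2 := (Z.sls b hb).con
        have h3 := Z.node hb (Z.eA b hb)
        rw [Z.pi_jump_none hj] at h3 ⊢
        rw [Z.jI b hb hj, ← he] at h2
        refine ((h.trans (h1.mono ?_)).trans (h2.symm.mono ?_)).trans h3.symm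
        · rintro x ⟨t, q1, q2, rfl⟩
          exact D4.Atom.P b _ t (by omega) q1 q2
        · exact fun x hx => D4.Atom.sl b x hb hj hx
      · intro i
        by_cases hi : Z.I b = i
        · subst hi
          rw [Z.pi_jump_some hj, Z.cur_jump hj]
          obtain ⟨s, hs, h⟩ := ih1
          exact ⟨s, hs, (h.trans (Z.node (by omega) (Z.oA b hb))).trans
            ((Z.sas b hb).con.mono fun x hx => D4.Atom.sa b x hb hj hx)⟩
        · have : ¬ (Z.jp b ∧ Z.I b = i) := fun h => hi h.2
          rw [Z.pi_other this, Z.cur_other this]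
          exact ih2 i
    · constructor
      · obtain ⟨v, v', h1, h2, h3⟩ := Z.conn b hb hj
        obtain ⟨s, hs, h⟩ := ih1
        refine ⟨s, hs, ?_⟩
        have h4 := Z.node hb h2
        rw [Z.pi_conn hj] at h4 ⊢
        exact ((h.trans (Z.node (by omega) h1)).trans
          (h3.mono fun x hx => D4.Atom.cs b x hb hj hx)).trans h4.symm
      · intro i
        have : ¬ (Z.jp b ∧ Z.I b = i) := fun h => hj h.1
        rw [Z.pi_other this, Z.cur_other this]
        exact ih2 i

theorem D4.paths {Lr D : ℕ} (hR : Rails G S T K Lr D n p) (κ : Option (Fin K)) :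
    ∃ s ∈ S, ∃ t ∈ T, Con G {x | Z.Atom x κ} s t := by
  obtain ⟨h1, h2⟩ := Z.fwd hR Z.M le_rfl
  obtain ⟨σ, rfl⟩ := (Z.pi Z.M).surjective κ
  cases σ with
  | none =>
    obtain ⟨s, hs, h⟩ := h1
    obtain ⟨t, ht, h'⟩ := Z.fin
    exact ⟨s, hs, t, ht, h.trans (Z.node le_rfl h')⟩
  | some i =>
    obtain ⟨s, hs, h⟩ := h2 i
    have he : Z.endp Z.M i = n i := by simp [D4.endp]
    have h3 := rail_con hR i (Z.cur Z.M i) (Z.endp Z.M i) (Z.cur_le le_rfl _)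
          (Z.endp_le le_rfl _)
    refine ⟨s, hs, p i (n i), hR.fin i, h.trans ?_⟩
    rw [← he]
    refine h3.mono ?_
    rintro x ⟨t, q1, q2, rfl⟩
    exact D4.Atom.P Z.M _ t le_rfl q1 q2

end CM

namespace CM
variable {V : Type} {G : SimpleGraph V} {W S T : Set V} {K : ℕ} {n : Fin K → ℕ}
  {p : Fin K → ℕ → V} {ρ c E H1 : ℕ}

/-- thinned chain data -/
structure D3 (G : SimpleGraph V) (W S T : Set V) {K : ℕ} (n : Fin K → ℕ) (p : Fin K → ℕ → V)
    (ρ E : ℕ) where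
  M : ℕ
  A : ℕ → V
  I : ℕ → Fin K
  Y : ℕ → ℕ
  X : ℕ → ℕ
  o : ℕ → V
  e : ℕ → V
  sa : ℕ → Set V
  sl : ℕ → Set V
  st : Tch G W S (A 0)
  fin : Tch G W T (A M)
  zero : M = 0 → A 0 ∈ W
  int : ∀ b, 0 < b → b < M → A b ∈ W
  yn : ∀ b, b < M → Y b ≤ n (I b)
  xn : ∀ b, b < M → X b ≤ n (I b)
  oA : ∀ b, b < M → Cl G W (A b) (o b)
  eA : ∀ b, b < M → Cl G W (A (b + 1)) (e b)
  sas : ∀ b, b < M → IsStr G ρ (sa b) (o b) (p (I b) (Y b))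
  sls : ∀ b, b < M → IsStr G ρ (sl b) (e b) (p (I b) (X b))
  gy : ∀ b b', b < b' → b' < M → I b = I b' → Y b + E ≤ Y b'
  gx : ∀ b b', b < b' → b' < M → I b = I b' → X b + 2 * E ≤ X b'
  g3 : ∀ b b', b < b' → b' < M → I b = I b' → Y b < X b' + E
  xy : ∀ b, b < M → X b + E ≤ Y b
  f3 : ∀ l b u, l < b → b < M → Cl G W (A l) u → ¬ Nr G ρ u (p (I b) (Y b))
  f4 : ∀ l b u, b + 1 < l → l ≤ M → Cl G W (A l) u → ¬ Nr G ρ u (p (I b) (X b))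
  f5 : ∀ l l', l < l' → l' ≤ M → A l ∈ W → A l' ∈ W → ¬ Con G W (A l) (A l')

lemma exists_str {o q : V} (h : Nr G ρ o q) : ∃ s, IsStr G ρ s o q := by
  obtain ⟨w, hw⟩ := h
  exact ⟨_, w, hw, rfl⟩

theorem exists_D3 (i0 : Fin K) {m : ℕ} {a : ℕ → V}
    (hf : IsFull G W S T n p ρ (4 * E) m a)
    (m1 : ∀ s u, s + 2 ≤ u → u ≤ m → ¬ J G W n p ρ (4 * E) (a s) (a u))
    (m2 : ∀ s u, s < u → u ≤ m → a s ∈ W → a u ∈ W → ¬ Con G W (a s) (a u)) :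
    Nonempty (D3 G W S T n p ρ E) := by
  classical
  have hJ : ∀ s, ∃ (i : Fin K) (y x : ℕ) (o e : V) (sa sl : Set V), s < m → y ≤ n i ∧
      x + 4 * E ≤ y ∧ Cl G W (a s) o ∧
      Cl G W (a (s + 1)) e ∧ IsStr G ρ sa o (p i y) ∧ IsStr G ρ sl e (p i x) := by
    intro s
    by_cases hs : s < m
    · obtain ⟨i, y, x, h1, h2, o, e, h3, h4, h5, h6⟩ := hf.jump s hs
      obtain ⟨sa, hsa⟩ := exists_str h4
      obtain ⟨sl, hsl⟩ := exists_str h6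
      exact ⟨i, y, x, o, e, sa, sl, fun _ => ⟨h1, h2, h3, h5, hsa, hsl⟩⟩
    · exact ⟨i0, 0, 0, a 0, a 0, ∅, ∅, fun h => (hs h).elim⟩
  choose i y x o e sa sl hh using hJ
  obtain ⟨N, t, t0, tN, tlt, ti, tg⟩ := thin m (4 * E) (3 * E) E E (2 * E) (by omega) (by omega) i x y
    (fun s hs => (hh s hs).2.1)
  have hlt : ∀ j, j < N → t j < m := fun j hj => by
    rw [← tN]; exact tau_lt tlt hj le_rfl
  have hle : ∀ j, j ≤ N → t j ≤ m := fun j hj => by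
    rw [← tN]; exact tau_le tlt hj le_rfl
  have hpred : ∀ j, j < N → t (j + 1) - 1 < m ∧ t (j + 1) - 1 + 1 = t (j + 1) := fun j hj => by
    have h1 := tlt j hj
    have h2 := hle (j + 1) hj
    omega
  refine ⟨{ M := N, A := fun j => a (t j), I := fun j => i (t j), Y := fun j => y (t j)
            X := fun j => x (t (j + 1) - 1), o := fun j => o (t j), e := fun j => e (t (j + 1) - 1)
            sa := fun j => sa (t j), sl := fun j => sl (t (j + 1) - 1)
            st := ?_, fin := ?_, zero := ?_, int := ?_, yn := ?_, xn := ?_, oA := ?_, eA := ?_,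
            sas := ?_, sls := ?_, gy := ?_, gx := ?_, g3 := ?_, xy := ?_, f3 := ?_, f4 := ?_,
            f5 := ?_ }⟩
  · simpa only [t0] using hf.st
  · simpa only [tN] using hf.fin
  · intro h
    subst h
    simpa only [t0] using hf.zero (by omega)
  · intro b h0 hb
    have := tau_lt tlt h0 hb.le
    exact hf.int _ (by omega) (hlt b hb)
  · exact fun b hb => (hh _ (hlt b hb)).1
  · intro b hb
    have h1 := hh _ (hpred b hb).1
    simp only [(ti b hb).1]
    omega
  · exact fun b hb => (hh _ (hlt b hb)).2.2.1
  · intro b hb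
    have h1 := (hh _ (hpred b hb).1).2.2.2.1
    rwa [(hpred b hb).2] at h1
  · exact fun b hb => (hh _ (hlt b hb)).2.2.2.2.1
  · intro b hb
    have h1 := (hh _ (hpred b hb).1).2.2.2.2.2
    simp only [(ti b hb).1]
    exact h1
  · intro b b' h1 h2 h3
    exact (tg b b' h1 h2 h3).1
  · intro b b' h1 h2 h3
    exact (tg b b' h1 h2 h3).2.1
  · intro b b' h1 h2 h3
    exact (tg b b' h1 h2 h3).2.2
  · exact fun b hb => (ti b hb).2
  · intro l b u hl hb hu hn
    have h1 := tau_lt tlt hl hb.le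
    obtain ⟨q1, q2, q3, q4, q5, q6⟩ := hh _ (hlt b hb)
    exact m1 (t l) (t b + 1) (by omega) (hlt b hb) ⟨_, _, _, q1, q2, u, _, hu, hn, q4, q6.nr q6.con.left⟩
  · intro l b u hl hb hu hn
    have h1 := tau_lt tlt hl hb
    have hb' : b < N := by omega
    obtain ⟨q1, q2, q3, q4, q5, q6⟩ := hh _ (hpred b hb').1
    have h2 := (hpred b hb').2
    simp only [(ti b hb').1] at hn
    exact m1 (t (b + 1) - 1) (t l) (by omega) (hle l hb)
      ⟨_, _, _, q1, q2, _, u, q3, q5.nr q5.con.left, hu, hn⟩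
  · intro l l' h1 h2 h3 h4
    exact m2 _ _ (tau_lt tlt h1 h2) (hle _ h2) h3 h4

lemma link {δ : ℕ} {z u : V} (h : Nr G δ z u) :
    ∃ P : Set V, Con G P z u ∧ ∀ x ∈ P, Nr G δ x z ∧ Nr G δ x u := by
  classical
  obtain ⟨w, hw⟩ := h
  refine ⟨{x | x ∈ w.support}, ⟨w, fun x hx => hx⟩, fun x hx => ?_⟩
  obtain ⟨w1, w2, h1, -, -⟩ := walk_split w hx
  exact ⟨Nr.symm ⟨w1, by omega⟩, ⟨w2, by omega⟩⟩

lemma conn_half {hW : ℕ} {s : Set V} {o z u : V} {i : Fin K} {y : ℕ} (hy : y ≤ n i)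
    (hs : IsStr G ρ s o (p i y)) (hz : z ∈ s) (hn : Nr G c z u) (hu : High G n p hW u)
    (e1 : H1 + ρ + 2 * c ≤ 2 * hW) (e2 : H1 + c ≤ hW) (e3 : c ≤ H1) :
    ∃ P : Set V, Con G P o u ∧ ∀ x ∈ P, High G n p c x ∧ (x ∈ s ∨ Nr G c x u) ∧
      ∃ z0 ∈ s, Nr G c x z0 ∧ High G n p H1 z0 := by
  have hz' : High G n p (hW - c) z := hu.nr hn (by omega)
  obtain ⟨P, p1, p2, p3, p4⟩ := IsStr.portion (h' := H1) hy hs hz hz' (by omega)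
  obtain ⟨Q, q1, q2⟩ := link hn
  refine ⟨P ∪ Q, (p1.mono Set.subset_union_left).trans (q1.mono Set.subset_union_right), ?_⟩
  rintro x (hx | hx)
  · exact ⟨(p3 x hx).mono e3, Or.inl (p2 hx), x, p2 hx, Nr.refl _ _, p3 x hx⟩
  · exact ⟨hu.nr (q2 x hx).2 (by omega), Or.inr (q2 x hx).2, z, hz, (q2 x hx).1,
      hz'.mono (by omega)⟩

variable (Z : D3 G W S T n p ρ E)

/-- shortcut relation -/
def D3.R3 (c H1 : ℕ) (j m : ℕ) : Prop :=
  (∃ z ∈ Z.sa j, ∃ u, Z.A m ∈ W ∧ Cl G W (Z.A m) u ∧ Nr G c z u) ∨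
  (∃ z ∈ Z.sl (m - 1), ∃ u, Z.A j ∈ W ∧ Cl G W (Z.A j) u ∧ Nr G c z u) ∨
  (∃ z ∈ Z.sa j, ∃ z' ∈ Z.sl (m - 1), Nr G (3 * c) z z' ∧ (High G n p H1 z ∨ High G n p H1 z'))

lemma D3.conn {hW : ℕ} (hhigh : ∀ w ∈ W, High G n p hW w) (e1 : H1 + ρ + 2 * c ≤ 2 * hW)
    (e2 : H1 + c ≤ hW) (e3 : 7 * c + ρ ≤ 2 * H1) (e4 : 4 * c ≤ H1) {j m : ℕ} (hj : j < m) (hm : m ≤ Z.M)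
    (h : Z.R3 c H1 j m) : ∃ cs : Set V,
    (∃ v v', Cl G W (Z.A j) v ∧ Cl G W (Z.A m) v' ∧ Con G cs v v') ∧ ∀ z ∈ cs,
    ConnPt G W n p ρ c H1 (Z.A j) (Z.A m) (Z.sa j) (Z.sl (m - 1))
    (p (Z.I j) (Z.Y j)) (p (Z.I (m - 1)) (Z.X (m - 1))) z := by
  have hj' : j < Z.M := by omega
  have hm' : m - 1 < Z.M := by omega
  have hoA := Z.oA j hj'
  have heA := Z.eA (m - 1) hm'
  rw [show m - 1 + 1 = m by omega] at heA
  rcases h with ⟨z, hz, u, h1, h2, h3⟩ | ⟨z, hz, u, h1, h2, h3⟩ | ⟨z, hz, z', hz', h1, h2⟩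
  · obtain ⟨P, p1, p2⟩ := conn_half (Z.yn j hj') (Z.sas j hj') hz h3 (hhigh u (h2.con h1).right) e1 e2
      (by omega)
    refine ⟨P, ⟨_, _, hoA, h2, p1⟩, fun x hx => ?_⟩
    obtain ⟨q1, q2, q3⟩ := p2 x hx
    refine ⟨q1, ?_, Or.inl q3⟩
    rcases q2 with q2 | q2
    · exact Or.inl q2
    · exact Or.inr (Or.inr (Or.inl ⟨u, Or.inr ⟨h2, h1⟩, q2⟩))
  · obtain ⟨P, p1, p2⟩ := conn_half (Z.xn _ hm') (Z.sls _ hm') hz h3 (hhigh u (h2.con h1).right) e1 e2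
      (by omega)
    refine ⟨P, ⟨_, _, h2, heA, p1.symm⟩, fun x hx => ?_⟩
    obtain ⟨q1, q2, q3⟩ := p2 x hx
    refine ⟨q1, ?_, Or.inr (Or.inl q3)⟩
    rcases q2 with q2 | q2
    · exact Or.inr (Or.inl q2)
    · exact Or.inr (Or.inr (Or.inl ⟨u, Or.inl ⟨h2, h1⟩, q2⟩))
  · have g1 : High G n p (H1 - 3 * c) z := by
      rcases h2 with h2 | h2
      · exact h2.mono (by omega)
      · exact h2.nr h1 (by omega)
    have g2 : High G n p (H1 - 3 * c) z' := by
      rcases h2 with h2 | h2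
      · exact h2.nr h1.symm (by omega)
      · exact h2.mono (by omega)
    obtain ⟨P, p1, p2, p3, p4⟩ := IsStr.portion (h' := c) (Z.yn j hj') (Z.sas j hj') hz g1 (by omega)
    obtain ⟨P', p1', p2', p3', p4'⟩ := IsStr.portion (h' := c) (Z.xn _ hm') (Z.sls _ hm') hz' g2
      (by omega)
    obtain ⟨Q, q1, q2⟩ := link h1
    have r1 := (Z.sas j hj').nr hz
    have r2 := (Z.sls _ hm').nr hz'
    refine ⟨P ∪ Q ∪ P', ⟨_, _, hoA, heA, ((p1.mono ?_).trans (q1.mono ?_)).trans (p1'.symm.mono ?_)⟩, ?_⟩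
    · exact fun x hx => Or.inl (Or.inl hx)
    · exact fun x hx => Or.inl (Or.inr hx)
    · exact fun x hx => Or.inr hx
    · rintro x ((hx | hx) | hx)
      · exact ⟨p3 x hx, Or.inl (p2 hx), Or.inr (Or.inr ⟨(p4 x hx).tr r1 (by omega),
          ((p4 x hx).trans h1).tr r2 (by omega)⟩)⟩
      · refine ⟨?_, Or.inr (Or.inr (Or.inr ⟨⟨z, hz, (q2 x hx).1⟩, ⟨z', hz', (q2 x hx).2⟩⟩)),
          Or.inr (Or.inr ⟨(q2 x hx).1.tr r1 (by omega), (q2 x hx).2.tr r2 (by omega)⟩)⟩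
        rcases h2 with h2 | h2
        · exact h2.nr (q2 x hx).1 (by omega)
        · exact h2.nr (q2 x hx).2 (by omega)
      · exact ⟨p3' x hx, Or.inr (Or.inl (p2' hx)), Or.inr (Or.inr
          ⟨((p4' x hx).trans h1.symm).tr r1 (by omega), (p4' x hx).tr r2 (by omega)⟩)⟩

theorem D3.toD4 (Z : D3 G W S T n p ρ E) {hW : ℕ} (hhigh : ∀ w ∈ W, High G n p hW w) (e1 : H1 + ρ + 2 * c ≤ 2 * hW)
    (e2 : H1 + c ≤ hW) (e3 : 7 * c + ρ ≤ 2 * H1) (e4 : 4 * c ≤ H1) :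
    Nonempty (D4 G W S T n p ρ c E H1) := by
  classical
  obtain ⟨M, t, t0, tM, tlt, tR, tmax⟩ := greedy (fun j m => m = j + 1 ∨ (j < m ∧ Z.R3 c H1 j m)) Z.M
    (fun s _ => Or.inl rfl)
  have hlt : ∀ j, j < M → t j < Z.M := fun j hj => by
    rw [← tM]; exact tau_lt tlt hj le_rfl
  have hle : ∀ j, j ≤ M → t j ≤ Z.M := fun j hj => by
    rw [← tM]; exact tau_le tlt hj le_rfl
  have hpred : ∀ j, j < M → t (j + 1) - 1 < Z.M ∧ t (j + 1) - 1 + 1 = t (j + 1) ∧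
      t j ≤ t (j + 1) - 1 := fun j hj => by
    have h1 := tlt j hj
    have h2 := hle (j + 1) hj
    omega
  have hjp : ∀ b, b < M → ¬ Z.R3 c H1 (t b) (t (b + 1)) → t (b + 1) = t b + 1 := by
    intro b hb h
    rcases tR b hb with h1 | h1
    · exact h1
    · exact (h h1.2).elim
  have hno : ∀ b l, (b + 2 ≤ l ∨ (l = b + 1 ∧ ¬ Z.R3 c H1 (t b) (t (b + 1)))) → l ≤ M →
      ¬ Z.R3 c H1 (t b) (t l) := by
    rintro b l (h | ⟨rfl, h⟩) hl hr
    · have q1 := tau_lt tlt (show b + 1 < l by omega) hl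
      have q2 := tlt b (by omega)
      exact tmax b (by omega) (t l) q1 (hle l hl) (Or.inr ⟨by omega, hr⟩)
    · exact h hr
  have hcs : ∀ b, ∃ cs : Set V, b < M → Z.R3 c H1 (t b) (t (b + 1)) →
      (∃ v v', Cl G W (Z.A (t b)) v ∧ Cl G W (Z.A (t (b + 1))) v' ∧ Con G cs v v') ∧ ∀ z ∈ cs,
      ConnPt G W n p ρ c H1 (Z.A (t b)) (Z.A (t (b + 1))) (Z.sa (t b)) (Z.sl (t (b + 1) - 1))
      (p (Z.I (t b)) (Z.Y (t b))) (p (Z.I (t (b + 1) - 1)) (Z.X (t (b + 1) - 1))) z := by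
    intro b
    by_cases h : b < M ∧ Z.R3 c H1 (t b) (t (b + 1))
    · obtain ⟨cs, hcs⟩ := Z.conn hhigh e1 e2 e3 e4 (tlt b h.1) (hle _ h.1) h.2
      exact ⟨cs, fun _ _ => hcs⟩
    · exact ⟨∅, fun h1 h2 => (h ⟨h1, h2⟩).elim⟩
  choose cs hcs using hcs
  refine ⟨{ M := M, A := fun j => Z.A (t j), jp := fun b => ¬ Z.R3 c H1 (t b) (t (b + 1))
            I := fun j => Z.I (t j), I' := fun j => Z.I (t (j + 1) - 1), Y := fun j => Z.Y (t j)
            X := fun j => Z.X (t (j + 1) - 1), o := fun j => Z.o (t j)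
            e := fun j => Z.e (t (j + 1) - 1)
            sa := fun j => Z.sa (t j), sl := fun j => Z.sl (t (j + 1) - 1), cs := cs
            st := ?_, fin := ?_, zero := ?_, int := ?_, yn := ?_, xn := ?_, oA := ?_, eA := ?_,
            sas := ?_, sls := ?_, gy := ?_, gx := ?_, gxy := ?_, jI := ?_, jxy := ?_, g3 := ?_,
            f3 := ?_, f4 := ?_, f5 := ?_, nA := ?_, nL := ?_, nAL := ?_, conn := ?_, cpt := ?_ }⟩
  · simpa only [t0] using Z.st
  · simpa only [tM] using Z.fin
  · intro h
    subst h
    simpa only [t0] using Z.zero (by omega)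
  · intro b h0 hb
    have := tau_lt tlt h0 hb.le
    exact Z.int _ (by omega) (hlt b hb)
  · exact fun b hb => Z.yn _ (hlt b hb)
  · exact fun b hb => Z.xn _ (hpred b hb).1
  · exact fun b hb => Z.oA _ (hlt b hb)
  · intro b hb
    have h1 := Z.eA _ (hpred b hb).1
    rwa [(hpred b hb).2.1] at h1
  · exact fun b hb => Z.sas _ (hlt b hb)
  · exact fun b hb => Z.sls _ (hpred b hb).1
  · exact fun b b' h1 h2 h3 => Z.gy _ _ (tau_lt tlt h1 h2.le) (hlt _ h2) h3
  · intro b b' h1 h2 h3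
    have q1 := tau_le tlt (show b + 1 ≤ b' by omega) h2.le
    have q2 := hpred b (by omega)
    have q3 := hpred b' h2
    have := Z.gx (t (b + 1) - 1) (t (b' + 1) - 1) (by omega) q3.1 h3
    show Z.X _ + E ≤ Z.X _
    omega
  · intro b b' h1 h2 h3
    have q1 := tau_le tlt (show b + 1 ≤ b' by omega) h2.le
    have q2 := hpred b (by omega)
    have := Z.gy (t (b + 1) - 1) (t b') (by omega) (hlt _ h2) h3
    have := Z.xy _ q2.1
    show Z.X _ + E ≤ Z.Y _
    omega
  · intro b hb hj
    show Z.I _ = Z.I _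
    rw [hjp b hb hj]
    simp
  · intro b hb hj
    show Z.X _ + E ≤ Z.Y _
    rw [hjp b hb hj]
    exact Z.xy _ (hlt b hb)
  · intro b0 b b' h1 h2 h3 j0 j1 j2 i1 i2
    show Z.Y _ + E ≤ Z.X _
    rw [hjp b' h3 j2]
    have q1 := tau_lt tlt h1 (by omega)
    have q2 := tau_lt tlt h2 (by omega)
    have := Z.g3 _ _ q1 (hlt _ (by omega)) i1
    have := Z.gx _ _ q2 (hlt _ h3) i2
    rw [show t b' + 1 - 1 = t b' by omega]
    omega
  · exact fun l b u h1 h2 h3 => Z.f3 _ _ u (tau_lt tlt h1 h2.le) (hlt _ h2) h3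
  · intro l b u h1 h2 h3
    have q1 := tau_lt tlt h1 h2
    have q2 := hpred b (by omega)
    exact Z.f4 (t l) _ u (by omega) (hle _ h2) h3
  · exact fun l l' h1 h2 h3 h4 => Z.f5 _ _ (tau_lt tlt h1 h2) (hle _ h2) h3 h4
  · intro b l u z h1 h2 h3 h4 h5 h6
    exact hno b l h1 h2 (Or.inl ⟨z, h5, u, h3, h4, h6⟩)
  · intro b b' u z h1 h2 h3 h4 h5 h6
    refine hno b (b' + 1) ?_ h2 (Or.inr (Or.inl ⟨z, h5, u, h3, h4, h6⟩))
    rcases h1 with h1 | ⟨rfl, h1⟩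
    · left; omega
    · exact Or.inr ⟨rfl, h1⟩
  · intro b b' z z' h1 h2 h3 h4 h5
    have := hno b (b' + 1) (Or.inl (by omega)) h2
    exact ⟨fun h => this (Or.inr (Or.inr ⟨z, h3, z', h4, h5, Or.inl h⟩)),
      fun h => this (Or.inr (Or.inr ⟨z, h3, z', h4, h5, Or.inr h⟩))⟩
  · intro b hb hj
    exact (hcs b hb (not_not.1 hj)).1
  · intro b z hb hj hz
    exact (hcs b hb (not_not.1 hj)).2 z hz

end CM

namespace CM
variable {V : Type} {G : SimpleGraph V}

theorem augment [Finite V] {S T : Set V} {c d K R1 r Lr D : ℕ} (i0 : Fin K)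
    (hR1 : R1 = d * (10 * c + 10)) (hr : r = 4 * R1 + 20 * c + 10)
    (hLr : Lr = 4 * (r + 1) + 10 * c + 10)
    (hN : ¬ HasNSubdivision G (binTree d) Lr)
    {n : Fin K → ℕ} {p : Fin K → ℕ → V} (hR : Rails G S T K Lr D n p) :
    (∃ (u v : Fin (K + 1) → V) (P : ∀ i, G.Walk (u i) (v i)),
      (∀ i, (P i).IsPath) ∧ (∀ i, u i ∈ S) ∧ (∀ i, v i ∈ T) ∧
      (∀ i j, i ≠ j →
        (c : ℕ∞) < eSetDist G {x | x ∈ (P i).support} {x | x ∈ (P j).support})) ∨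
    ∃ x : Fin K → ℕ, ∀ s t (w : G.Walk s t), s ∈ S → t ∈ T →
      ∃ y ∈ w.support, ∃ i, Nr G (r + 4 * (D + 1)) y (p i (x i)) := by
  classical
  have hN' : ¬ HasNSubdivision G (binTree d) (10 * c + 10) := fun h =>
    hN (hasN_mono h (by omega))
  obtain ⟨W, w1, w2, w3⟩ := hull hN' {v | High G n p r v}
  have hcov : ∀ v, v ∉ W → ∃ i a, a ≤ n i ∧ Nr G r v (p i a) := by
    intro v hv
    by_contra hc
    push Not at hc
    exact hv (w1 (fun i a ha => hc i a ha))
  have hhigh : ∀ w ∈ W, High G n p (r - R1) w := by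
    intro w hw
    obtain ⟨y, hy, hn⟩ := w2 w hw
    rw [← hR1] at hn
    exact High.nr hy hn (by omega)
  by_cases hex : ∃ m a, IsFull G W S T n p (r + 1) (4 * (D + 1)) m a
  · left
    obtain ⟨m, a, h1, h2, h3⟩ := min_full hex
    obtain ⟨Z3⟩ := exists_D3 i0 h1 h2 h3
    obtain ⟨Z⟩ := Z3.toD4 (c := c) (H1 := 2 * R1 + 18 * c + 9) hhigh (by omega) (by omega) (by omega)
      (by omega)
    have hp := Z.paths hR
    choose s hs t ht w hw using hp
    let f := finSuccEquiv K
    refine ⟨fun i => s (f i), fun i => t (f i), fun i => (w (f i)).bypass,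
      fun i => Walk.bypass_isPath _, fun i => hs _, fun i => ht _, ?_⟩
    intro i j hij
    refine eSetDist_lt_of _ _ _ _ ?_
    intro x hx y hy hn
    have a1 := hw _ x (Walk.support_bypass_subset_support _ hx)
    have a2 := hw _ y (Walk.support_bypass_subset_support _ hy)
    have := Z.sep hR (by omega) (by omega) (fun u hu u' hu' h => (w3 u hu u' hu' (h.mono (by omega))).con)
      (fun w hw => (hhigh w hw).mono (by omega)) a1 a2 hn
    exact hij (f.injective this)
  · right
    push Not at hex
    exact cut hR hcov rfl (by omega) le_rfl (by omega) hex

theorem main (d k : ℕ) : ∀ c : ℕ,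
    ∃ f g : ℕ, ∀ (V : Type) [Fintype V], ∀ G : SimpleGraph V,
      ¬ HasNSubdivision G (binTree d) f →
      ∀ S T : Set V,
        (∃ (u v : Fin (k + 1) → V) (P : ∀ i, G.Walk (u i) (v i)),
          (∀ i, (P i).IsPath) ∧ (∀ i, u i ∈ S) ∧ (∀ i, v i ∈ T) ∧
          (∀ i j, i ≠ j →
            (c : ℕ∞) < eSetDist G {x | x ∈ (P i).support} {x | x ∈ (P j).support})) ∨
        (∃ X : Finset V, X.card ≤ k ∧
          ∀ (a b : V) (w : G.Walk a b), w.IsPath → a ∈ S → b ∈ T →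
            ∃ y ∈ w.support, ∃ x ∈ X, eSetDist G {y} {x} ≤ (g : ℕ∞)) := by
  classical
  induction k with
  | zero =>
    intro c
    refine ⟨0, 0, fun V _ G _ S T => ?_⟩
    by_cases h : ∃ (a b : V) (w : G.Walk a b), w.IsPath ∧ a ∈ S ∧ b ∈ T
    · obtain ⟨a, b, w, h1, h2, h3⟩ := h
      left
      refine ⟨fun _ => a, fun _ => b, fun _ => w, fun _ => h1, fun _ => h2, fun _ => h3, ?_⟩
      intro i j hij
      exact (hij (Subsingleton.elim (α := Fin 1) i j)).elim
    · right
      refine ⟨∅, by simp, fun a b w h1 h2 h3 => (h ⟨a, b, w, h1, h2, h3⟩).elim⟩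
  | succ k ih =>
    intro c
    obtain ⟨R1, hR1⟩ : ∃ R1, R1 = d * (10 * c + 10) := ⟨_, rfl⟩
    obtain ⟨r, hr⟩ : ∃ r, r = 4 * R1 + 20 * c + 10 := ⟨_, rfl⟩
    obtain ⟨Lr, hLr⟩ : ∃ Lr, Lr = 4 * (r + 1) + 10 * c + 10 := ⟨_, rfl⟩
    obtain ⟨f, g, hfg⟩ := ih (Lr + 2 * d * Lr)
    refine ⟨max f Lr, max g (r + 4 * (Lr * (2 * d * Lr + 1) + 1)), fun V _ G hN S T => ?_⟩
    have hN1 : ¬ HasNSubdivision G (binTree d) f := fun h => hN (hasN_mono h (le_max_left _ _))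
    have hN2 : ¬ HasNSubdivision G (binTree d) Lr := fun h => hN (hasN_mono h (le_max_right _ _))
    rcases hfg V G hN1 S T with ⟨u, v, P, h1, h2, h3, h4⟩ | ⟨X, hX, h⟩
    · obtain ⟨n, p, hR⟩ := exists_rails hN2 u v P h2 h3 (fun i j hij x hx y hy =>
        not_nr_of_eSetDist (h4 i j hij) x hx y hy)
      rcases augment (0 : Fin (k + 1)) hR1 hr hLr hN2 hR with h | ⟨x, hx⟩
      · exact Or.inl h
      · right
        refine ⟨Finset.univ.image (fun i => p i (x i)), ?_, ?_⟩
        · exact Finset.card_image_le.trans (by simp)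
        · intro a b w _ ha hb
          obtain ⟨y, hy, i, hi⟩ := hx a b w ha hb
          exact ⟨y, hy, p i (x i), by simp, eSetDist_le_of_nr (hi.mono (le_max_right _ _))⟩
    · right
      refine ⟨X, by omega, fun a b w hw ha hb => ?_⟩
      obtain ⟨y, hy, x, hx, hd⟩ := h a b w hw ha hb
      refine ⟨y, hy, x, hx, hd.trans ?_⟩
      exact_mod_cast le_max_left _ _

end CM

/-- Main theorem: there exist `f k c d` and `g k c d` such that every finite graph with no
`f k c d`-subdivision of the uniform binary tree `H_d` satisfies the coarse Menger property
with separation `> c` and radius `g k c d`. -/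
theorem coarseMenger_treeform (k c d : ℕ) :
    ∃ f g : ℕ, ∀ (V : Type) [Fintype V], ∀ G : SimpleGraph V,
      ¬ HasNSubdivision G (binTree d) f →
      ∀ S T : Set V,
        (∃ (u v : Fin (k + 1) → V) (P : ∀ i, G.Walk (u i) (v i)),
          (∀ i, (P i).IsPath) ∧ (∀ i, u i ∈ S) ∧ (∀ i, v i ∈ T) ∧
          (∀ i j, i ≠ j →
            (c : ℕ∞) < eSetDist G {x | x ∈ (P i).support} {x | x ∈ (P j).support})) ∨
        (∃ X : Finset V, X.card ≤ k ∧
          ∀ (a b : V) (w : G.Walk a b), w.IsPath → a ∈ S → b ∈ T →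
            ∃ y ∈ w.support, ∃ x ∈ X, eSetDist G {y} {x} ≤ (g : ℕ∞)) :=
  CM.main d k c
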